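/- The homogeneous parts of the operator 𝒢^{(α)} in degrees 0 and 1 are given by: 𝒢_0^{(α)} = Ψ, and 𝒢_1^{(α)} = ∑_{m≥1} ∑_{m1+m2=m+1, m1,m2≥1} q_{m1} r_{m2} · Ψ · (m ∂/∂p_m). In particular, for every partition π, ∑_{|μ|+|ν|=|π|} g^π_{μ,ν}(α) q_μ r_ν = ∏_{1≤i≤ℓ(π)} (q_{π_i}+r_{π_i}). -/

import Mathlib

open scoped Classical

noncomputable section

/-- The base field `ℚ(α)` of rational functions in the Jack parameter `α`. -/
abbrev F : Type := RatFunc ℚ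

/-- The Jack deformation parameter `α`. -/
def alpha : F := RatFunc.X

/-- An integer partition, encoded as a multiset of positive integers (its parts). -/
abbrev JPartition : Type := Multiset ℕ+

/-- The size `|λ|` of a partition. -/
def psize (l : JPartition) : ℕ := (l.map fun i => (i : ℕ)).sum

/-- The length `ℓ(λ)` of a partition. -/
def plen (l : JPartition) : ℕ := Multiset.card l

/-- `m_i(λ)`, the number of parts of `λ` equal to `i`. -/
def pmult (l : JPartition) (i : ℕ+) : ℕ := Multiset.count i l

/-- `λ ∪ 1^k`, adjoining `k` parts equal to `1`. -/
def addOnes (l : JPartition) (k : ℕ) : JPartition := l + Multiset.replicate k 1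

/-- `λ̃`, the partition obtained by deleting all parts equal to `1`. -/
def removeOnes (l : JPartition) : JPartition := Multiset.filter (fun i => i ≠ 1) l

/-- Exponent vectors of monomials in the power-sum generators `p₁, p₂, …`. -/
abbrev Exp : Type := ℕ+ →₀ ℕ

/-- The exponent vector of the monomial `p_λ`. -/
def toExp (l : JPartition) : Exp := l.toFinset.sum fun i => Finsupp.single i (Multiset.count i l)

/-- The partition corresponding to an exponent vector. -/
def toPart (m : Exp) : JPartition := m.sum fun i k => Multiset.replicate k i

/-- The weighted degree (`deg p_i = i`) of an exponent vector; this is the size of the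
corresponding partition. -/
def wt (m : Exp) : ℕ := m.sum fun i k => k * (i : ℕ)

/-- The algebra `ℚ(α)[p₁, p₂, …]` of symmetric functions written in the power-sum basis. -/
abbrev SymA : Type := MvPolynomial ℕ+ F

/-- The power-sum monomial `p_λ`. -/
def pPow (l : JPartition) : SymA := (l.map fun i => MvPolynomial.X i).prod

/-- `z_λ α^{ℓ(λ)}`, attached to the exponent vector of `p_λ`. -/
def zalpha (m : Exp) : F :=
  algebraMap ℚ F (m.prod fun i k => (Nat.factorial k : ℚ) * ((i : ℕ) : ℚ) ^ k) *
    alpha ^ (m.sum fun _ k => k)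

/-- The `α`-deformed Hall scalar product: `⟨p_λ, p_μ⟩ = δ_{λμ} z_λ α^{ℓ(λ)}`. -/
def hall (f g : SymA) : F :=
  ∑ m ∈ f.support, MvPolynomial.coeff m f * MvPolynomial.coeff m g * zalpha m

/-- The parts of a partition, sorted in weakly decreasing order. -/
def sortedParts (l : JPartition) : List ℕ := ((l.map fun i => (i : ℕ)).sort (· ≤ ·)).reverse

/-- The sum of the `k` largest parts of a partition. -/
def topSum (l : JPartition) (k : ℕ) : ℕ := ((sortedParts l).take k).sum

/-- The dominance order on partitions: `μ ⊴ λ`. -/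
def dominates (mu lam : JPartition) : Prop :=
  psize mu = psize lam ∧ ∀ k, topSum mu k ≤ topSum lam k

/-- Evaluation of a symmetric function (in power-sum coordinates) in `N` variables
`x₁, …, x_N`: it sends `p_i ↦ x₁^i + ⋯ + x_N^i`. -/
def evalN (N : ℕ) : SymA →ₐ[F] MvPolynomial (Fin N) F :=
  MvPolynomial.aeval fun i : ℕ+ => ∑ j : Fin N, MvPolynomial.X j ^ (i : ℕ)

/-- The exponent of the monomial `x₁^{μ₁} ⋯ x_s^{μ_s}` in `N` variables, for `μ` a
partition; its coefficient in a symmetric polynomial is the coefficient of the monomial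
symmetric function `m_μ` (provided `N ≥ ℓ(μ)`). -/
def xexp (mu : JPartition) (N : ℕ) : Fin N →₀ ℕ :=
  Finsupp.equivFunOnFinite.symm fun j => (sortedParts mu).getD (j : ℕ) 0

/-- The defining properties of the family of Jack polynomials `J_λ^{(α)}` (Macdonald's
characterization): orthogonality for the `α`-deformed Hall product, triangularity with
respect to monomial symmetric functions in dominance order, and normalization
`[p_{1^n}] J_λ^{(α)} = 1`. -/
structure IsJackFamily (J : JPartition → SymA) : Prop where
  orthogonal : ∀ l m : JPartition, l ≠ m → hall (J l) (J m) = 0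
  triangular : ∀ l m : JPartition, ¬ dominates m l →
    MvPolynomial.coeff (xexp m (psize l + psize m + plen m))
      (evalN (psize l + psize m + plen m) (J l)) = 0
  normalized : ∀ l : JPartition, MvPolynomial.coeff (Finsupp.single 1 (psize l)) (J l) = 1

/-- The Jack character `θ_μ^{(α)}(λ)`. -/
def theta (J : JPartition → SymA) (mu lam : JPartition) : F :=
  if psize lam < psize mu then 0
  else (Nat.choose (psize lam - psize mu + pmult mu 1) (pmult mu 1) : F) *
    MvPolynomial.coeff (toExp (addOnes mu (psize lam - psize mu))) (J lam)

/-- `g` is the family of structure coefficients of Jack characters: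
`θ_μ^{(α)} θ_ν^{(α)} = ∑_π g^π_{μ,ν}(α) θ_π^{(α)}` (as functions on Young diagrams,
with finitely many nonzero terms). -/
def IsStructCoeffs (J : JPartition → SymA) (g : JPartition → JPartition → JPartition → F) :
    Prop :=
  (∀ mu nu : JPartition, {pi : JPartition | g pi mu nu ≠ 0}.Finite) ∧
  ∀ mu nu lam : JPartition,
    theta J mu lam * theta J nu lam = ∑ᶠ pi : JPartition, g pi mu nu * theta J pi lam


/-- The polynomial algebra `ℚ(α)[q,r]` in the two alphabets `q` (left) and `r` (right). -/
abbrev QR : Type := MvPolynomial (ℕ+ ⊕ ℕ+) F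

/-- The variable `q_i`. -/
def qv (i : ℕ+) : QR := MvPolynomial.X (Sum.inl i)

/-- The variable `r_i`. -/
def rv (i : ℕ+) : QR := MvPolynomial.X (Sum.inr i)

/-- The monomial `q_μ r_ν`. -/
def qrMon (mu nu : JPartition) : QR :=
  (mu.map fun i => qv i).prod * (nu.map fun i => rv i).prod

/-- The linear operator `Ψ(p,q,r) : ℚ(α)[p] → ℚ(α)[q,r]`,
`p_π ↦ ∏_{1≤i≤ℓ(π)} (q_{π_i} + r_{π_i})`. -/
def Psi (f : SymA) : QR :=
  ∑ m ∈ f.support, MvPolynomial.coeff m f • ((toPart m).map fun i => qv i + rv i).prod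

/-- The homogeneous part `𝒢_k^{(α)} : ℚ(α)[p] → ℚ(α)[q,r]` of the operator `𝒢^{(α)}`:
`𝒢_k^{(α)} ⬝ p_π = ∑_{|μ|+|ν|=|π|+k} g^π_{μ,ν}(α) q_μ r_ν`. -/
def Gk (g : JPartition → JPartition → JPartition → F) (k : ℕ) (f : SymA) : QR :=
  ∑ m ∈ f.support, MvPolynomial.coeff m f •
    ∑ᶠ mu : JPartition, ∑ᶠ nu : JPartition,
      if psize mu + psize nu = wt m + k then g (toPart m) mu nu • qrMon mu nu else 0


namespace JA

open MvPolynomial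

/-! ### Weights, the Hall pairing -/

lemma alpha_ne_zero : alpha ≠ 0 := RatFunc.X_ne_zero

lemma wt_add (a b : Exp) : wt (a + b) = wt a + wt b := by
  unfold wt
  exact Finsupp.sum_add_index' (by simp) (by intros; ring)

lemma wt_single (i : ℕ+) (k : ℕ) : wt (Finsupp.single i k) = k * i := by
  unfold wt
  exact Finsupp.sum_single_index (by simp)

lemma zalpha_ne_zero (m : Exp) : zalpha m ≠ 0 := by
  unfold zalpha
  refine mul_ne_zero ?_ (pow_ne_zero _ alpha_ne_zero)
  rw [Ne, map_eq_zero]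
  refine Finset.prod_ne_zero_iff.2 fun i _ => ?_
  have : ((i : ℕ) : ℚ) ≠ 0 := by exact_mod_cast i.ne_zero
  positivity

lemma zalpha_zero : zalpha 0 = 1 := by simp [zalpha]

lemma zalpha_add_single (m : Exp) (t : ℕ+) :
    zalpha (m + Finsupp.single t 1) =
      zalpha m * ((m t + 1 : ℕ) : F) * ((t : ℕ) : F) * alpha := by
  have h1 : ((m + Finsupp.single t 1).prod
      fun (i : ℕ+) k => (Nat.factorial k : ℚ) * ((i : ℕ) : ℚ) ^ k)
      = (m.prod fun (i : ℕ+) k => (Nat.factorial k : ℚ) * ((i : ℕ) : ℚ) ^ k) *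
        ((m t + 1 : ℕ) : ℚ) * ((t : ℕ) : ℚ) := by
    set s := insert t m.support with hs
    have e1 : (m + Finsupp.single t 1).support ⊆ s := by
      intro i hi
      by_cases h : i = t
      · simp [hs, h]
      · simp [Finsupp.single_apply, Ne.symm h] at hi
        simp [hs, hi]
    rw [Finsupp.prod_of_support_subset _ e1 _ (by simp),
      Finsupp.prod_of_support_subset m (Finset.subset_insert _ _) _ (by simp), ← hs,
      ← Finset.mul_prod_erase s _ (a := t) (by simp [hs]),
      ← Finset.mul_prod_erase s (fun i : ℕ+ => (Nat.factorial (m i) : ℚ) * ((i : ℕ) : ℚ) ^ (m i))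
        (a := t) (by simp [hs])]
    have e2 : ∏ x ∈ s.erase t, (Nat.factorial ((m + Finsupp.single t 1 : Exp) x) : ℚ) *
        ((x : ℕ) : ℚ) ^ ((m + Finsupp.single t 1 : Exp) x)
        = ∏ x ∈ s.erase t, (Nat.factorial (m x) : ℚ) * ((x : ℕ) : ℚ) ^ (m x) := by
      refine Finset.prod_congr rfl fun x hx => ?_
      have : x ≠ t := Finset.ne_of_mem_erase hx
      simp [Finsupp.single_apply, Ne.symm this]
    rw [e2]
    simp [Nat.factorial_succ, pow_succ]
    ring
  have h2 : ((m + Finsupp.single t 1).sum fun _ k => k) = (m.sum fun _ k => k) + 1 := by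
    rw [Finsupp.sum_add_index' (by simp) (by simp), Finsupp.sum_single_index rfl]
  unfold zalpha
  rw [h1, h2]
  simp only [map_mul, map_natCast, pow_succ]
  ring

lemma hall_eq_sum {f g : SymA} {s : Finset Exp} (hs : f.support ⊆ s) :
    hall f g = ∑ m ∈ s, coeff m f * coeff m g * zalpha m := by
  unfold hall
  refine Finset.sum_subset hs fun m _ hm => ?_
  rw [notMem_support_iff.1 hm]; simp

/-- the Hall pairing as a bilinear map -/
def hallL : SymA →ₗ[F] SymA →ₗ[F] F :=
  LinearMap.mk₂ F hall
    (by
      intro f f' g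
      rw [hall_eq_sum (support_add (p := f) (q := f')),
        hall_eq_sum (g := g) (Finset.subset_union_left (s₁ := f.support) (s₂ := f'.support)),
        hall_eq_sum (g := g) (Finset.subset_union_right (s₁ := f.support) (s₂ := f'.support)),
        ← Finset.sum_add_distrib]
      refine Finset.sum_congr rfl fun m _ => ?_
      rw [coeff_add]; ring)
    (by
      intro c f g
      rw [hall_eq_sum (support_smul (a := c) (f := f)), hall, smul_eq_mul, Finset.mul_sum]
      refine Finset.sum_congr rfl fun m _ => ?_
      rw [coeff_smul, smul_eq_mul]; ring)
    (by
      intro f g g'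
      simp only [hall, ← Finset.sum_add_distrib]
      refine Finset.sum_congr rfl fun m _ => ?_
      rw [coeff_add]; ring)
    (by
      intro c f g
      simp only [hall, smul_eq_mul, Finset.mul_sum]
      refine Finset.sum_congr rfl fun m _ => ?_
      rw [coeff_smul, smul_eq_mul]; ring)

lemma hallL_apply (f g : SymA) : hallL f g = hall f g := rfl

lemma hallL_monomial_left (m : Exp) (c : F) (g : SymA) :
    hallL (monomial m c) g = c * coeff m g * zalpha m := by
  rw [hallL_apply, hall_eq_sum (support_monomial_subset (s := m) (a := c))]
  simp

lemma hallL_symm (f g : SymA) : hallL f g = hallL g f := by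
  rw [hallL_apply, hallL_apply,
    hall_eq_sum (g := g) (Finset.subset_union_left (s₁ := f.support) (s₂ := g.support)),
    hall_eq_sum (g := f) (Finset.subset_union_right (s₁ := f.support) (s₂ := g.support))]
  exact Finset.sum_congr rfl fun m _ => by ring

lemma hallL_monomial_right (m : Exp) (c : F) (g : SymA) :
    hallL g (monomial m c) = c * coeff m g * zalpha m := by
  rw [hallL_symm, hallL_monomial_left]

/-- extension of a linear identity from monomials -/
lemma lin_ext {M : Type*} [AddCommMonoid M] [Module F M] {σ : Type*}
    {A B : MvPolynomial σ F →ₗ[F] M}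
    (h : ∀ m, A (monomial m 1) = B (monomial m 1)) : A = B := by
  exact (basisMonomials σ F).ext fun s => by simpa using h s

/-- `p_t`, with `p_0 = 0` -/
def pp (t : ℕ) : SymA := if h : 0 < t then X (Nat.toPNat t h) else 0

/-- `α t ∂_t` -/
def dd (t : ℕ) : SymA →ₗ[F] SymA :=
  if h : 0 < t then (alpha * (t : F)) • (pderiv (R := F) (Nat.toPNat t h)).toLinearMap else 0

lemma pp_pnat (t : ℕ+) : pp t = X t := by simp [pp]; rfl
lemma pp_zero : pp 0 = 0 := by simp [pp]
lemma dd_zero : dd 0 = 0 := by simp [dd]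
lemma dd_pnat (t : ℕ+) (f : SymA) : dd t f = (alpha * ((t : ℕ) : F)) • pderiv t f := by
  have : (0 : ℕ) < t := t.pos
  rw [dd, dif_pos this]
  rfl

lemma hall_adj1 (t : ℕ) (f g : SymA) : hallL (pp t * f) g = hallL f (dd t g) := by
  rcases Nat.eq_zero_or_pos t with rfl | ht
  · simp [pp_zero, dd_zero]
  obtain ⟨t, rfl⟩ : ∃ t' : ℕ+, t = t' := ⟨⟨t, ht⟩, rfl⟩
  have : (hallL ∘ₗ (LinearMap.mulLeft F (pp t))) = (hallL.compl₂ (dd t)) := by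
    refine lin_ext fun m => LinearMap.ext fun g => ?_
    simp only [LinearMap.comp_apply, LinearMap.compl₂_apply, LinearMap.mulLeft_apply]
    rw [pp_pnat, dd_pnat, mul_comm, X, monomial_mul, hallL_monomial_left, map_smul,
      hallL_monomial_left, coeff_pderiv, zalpha_add_single]
    simp only [smul_eq_mul]
    push_cast
    ring
  exact LinearMap.congr_fun (LinearMap.congr_fun this f) g

lemma hall_adj2 (t : ℕ) (f g : SymA) : hallL (dd t f) g = hallL f (pp t * g) := by
  rw [hallL_symm, ← hall_adj1, hallL_symm]

/-! ### positive definiteness -/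

lemma ratfunc_pos {ι : Type*} (s : Finset ι) (c : ι → F) (w : ι → ℚ) (e : ι → ℕ)
    (hw : ∀ i ∈ s, 0 < w i)
    (h : ∑ i ∈ s, c i * c i * (algebraMap ℚ F (w i) * alpha ^ (e i)) = 0) :
    ∀ i ∈ s, c i = 0 := by
  obtain ⟨d, hd⟩ := IsLocalization.exist_integer_multiples (nonZeroDivisors (Polynomial ℚ)) s c
  choose! n hn using hd
  have hd0 : algebraMap (Polynomial ℚ) F (d : Polynomial ℚ) ≠ 0 := by
    simpa using nonZeroDivisors.ne_zero d.2
  have hn' : ∀ i ∈ s, algebraMap (Polynomial ℚ) F (n i) = algebraMap (Polynomial ℚ) F d * c i := by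
    intro i hi
    rw [hn i hi, Algebra.smul_def]
  have key : ∑ i ∈ s, n i * n i * (Polynomial.C (w i) * Polynomial.X ^ (e i)) = 0 := by
    apply RatFunc.algebraMap_injective ℚ
    rw [map_zero, map_sum]
    have : ∀ i ∈ s, algebraMap (Polynomial ℚ) F
        (n i * n i * (Polynomial.C (w i) * Polynomial.X ^ (e i))) =
        (algebraMap (Polynomial ℚ) F d * algebraMap (Polynomial ℚ) F d) *
          (c i * c i * (algebraMap ℚ F (w i) * alpha ^ (e i))) := by
      intro i hi
      have hX : algebraMap (Polynomial ℚ) F Polynomial.X = alpha := RatFunc.algebraMap_X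
      have hC : algebraMap (Polynomial ℚ) F (Polynomial.C (w i)) = algebraMap ℚ F (w i) := by
        rw [RatFunc.algebraMap_C, eq_ratCast, eq_ratCast]
      rw [map_mul, map_mul, map_mul, map_pow, hn' i hi, hX, hC]
      ring
    rw [Finset.sum_congr rfl this, ← Finset.mul_sum, h, mul_zero]
  intro i hi
  have hz : n i = 0 := by
    apply Polynomial.eq_zero_of_infinite_isRoot
    refine (Set.Ioi_infinite (0 : ℚ)).mono fun a ha => ?_
    have ha : 0 < a := ha
    have h1 := congrArg (Polynomial.eval a) key
    rw [Polynomial.eval_finsetSum, Polynomial.eval_zero] at h1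
    have h2 := (Finset.sum_eq_zero_iff_of_nonneg (fun j hj => ?_)).1 h1 i hi
    · have := hw i hi
      simp only [Polynomial.eval_mul, Polynomial.eval_C, Polynomial.eval_pow, Polynomial.eval_X,
        mul_eq_zero, or_self, this.ne', pow_eq_zero_iff', ha.ne', false_and, or_false] at h2
      exact h2
    · simp only [Polynomial.eval_mul, Polynomial.eval_C, Polynomial.eval_pow, Polynomial.eval_X]
      have := hw j hj
      have := mul_self_nonneg (Polynomial.eval a (n j))
      positivity
  have := hn' i hi
  rw [hz, map_zero] at this
  simpa [hd0] using this.symm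

lemma hall_self {f : SymA} (h : hallL f f = 0) : f = 0 := by
  rw [hallL_apply, hall] at h
  simp only [zalpha] at h
  have := ratfunc_pos _ _ _ _ (fun m hm => ?_) h
  · ext m
    by_cases hm : m ∈ f.support
    · simpa using this m hm
    · simpa using hm
  · refine Finset.prod_pos fun i _ => ?_
    have : (0 : ℚ) < ((i : ℕ) : ℚ) := by exact_mod_cast i.pos
    positivity

end JA

namespace JA

open MvPolynomial

/-! ### The Nazarov–Sklyanin type operator -/

abbrev VY : Type := Polynomial SymA

/-- derivation `p_k ↦ α k y^k` -/
def nabla : Derivation F SymA VY :=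
  mkDerivation F (fun k : ℕ+ => (alpha * ((k : ℕ) : F)) • (Polynomial.X ^ (k : ℕ) : VY))

lemma nabla_X (k : ℕ+) : nabla (X k) = (alpha * ((k : ℕ) : F)) • (Polynomial.X ^ (k : ℕ) : VY) :=
  mkDerivation_X _ _ _

lemma coeff_nabla (l : ℕ) (f : SymA) : (nabla f).coeff l = dd l f := by
  rcases Nat.eq_zero_or_pos l with rfl | hl
  · have : (Polynomial.lcoeff SymA 0).compDer nabla = 0 := by
      refine derivation_ext fun i => ?_
      have : 0 ≠ (i : ℕ) := i.ne_zero.symm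
      simp [nabla_X, Polynomial.coeff_X_pow, this]
    have h := congrArg (fun D => D f) this
    simpa [dd_zero] using h
  · obtain ⟨l, rfl⟩ : ∃ t' : ℕ+, l = t' := ⟨⟨l, hl⟩, rfl⟩
    have : (Polynomial.lcoeff SymA (l : ℕ)).compDer nabla
        = (alpha * ((l : ℕ) : F)) • pderiv (R := F) l := by
      refine derivation_ext fun i => ?_
      by_cases h : l = i
      · subst h
        simp [nabla_X, Polynomial.coeff_X_pow]
      · have h' : (l : ℕ) ≠ i := fun e => h (PNat.coe_injective e)
        simp [nabla_X, Polynomial.coeff_X_pow, h', pderiv_X_of_ne (Ne.symm h)]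
    have h := congrArg (fun D => D f) this
    rw [dd_pnat]
    simpa using h

def Lmon (e : F) (m : ℕ) : SymA →ₗ[F] VY :=
  (LinearMap.mulRight F (Polynomial.X ^ m : VY)) ∘ₗ nabla.toLinearMap
  + e • ((Polynomial.monomial (m + 1)).restrictScalars F)
  + ((alpha - 1) * (m : F)) • ((Polynomial.monomial m).restrictScalars F)
  + ∑ t ∈ Finset.range m,
      ((Polynomial.monomial (m - 1 - t)).restrictScalars F) ∘ₗ LinearMap.mulLeft F (pp (t + 1))

lemma Lmon_apply (e : F) (m : ℕ) (f : SymA) : Lmon e m f =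
    nabla f * Polynomial.X ^ m + e • Polynomial.monomial (m + 1) f
    + ((alpha - 1) * (m : F)) • Polynomial.monomial m f
    + ∑ t ∈ Finset.range m, Polynomial.monomial (m - 1 - t) (pp (t + 1) * f) := by
  simp [Lmon]

lemma coeff_Lmon (e : F) (m l : ℕ) (f : SymA) : (Lmon e m f).coeff l =
    dd (l - m) f + (if l = m + 1 then e • f else 0)
      + (if l = m then ((alpha - 1) * (m : F)) • f else 0) + pp (m - l) * f := by
  have h1 : (nabla f * Polynomial.X ^ m : VY).coeff l = dd (l - m) f := by
    rw [Polynomial.coeff_mul_X_pow']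
    split_ifs with h
    · rw [coeff_nabla]
    · rw [Nat.sub_eq_zero_of_le (by omega), dd_zero]; rfl
  have h2 : ∑ t ∈ Finset.range m, (Polynomial.monomial (m - 1 - t) (pp (t + 1) * f)).coeff l
      = pp (m - l) * f := by
    simp only [Polynomial.coeff_monomial]
    by_cases h : l < m
    · rw [Finset.sum_eq_single (m - 1 - l)]
      · rw [if_pos (by omega), show m - 1 - l + 1 = m - l by omega]
      · intro b hb hne
        rw [if_neg]
        have := Finset.mem_range.1 hb
        omega
      · intro h'
        simp at h'
        omega
    · rw [show m - l = 0 by omega, pp_zero, zero_mul]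
      refine Finset.sum_eq_zero fun t ht => if_neg ?_
      have := Finset.mem_range.1 ht
      omega
  rw [Lmon_apply]
  rw [Polynomial.coeff_add, Polynomial.coeff_add, Polynomial.coeff_add, h1,
    Polynomial.finsetSum_coeff, h2, Polynomial.coeff_smul, Polynomial.coeff_smul,
    Polynomial.coeff_monomial, Polynomial.coeff_monomial]
  simp only [smul_ite, smul_zero, eq_comm (a := m + 1), eq_comm (a := m)]

def LL (e : F) : VY →ₗ[F] VY := Polynomial.lsum (Lmon e)

lemma LL_monomial (e : F) (m : ℕ) (f : SymA) : LL e (Polynomial.monomial m f) = Lmon e m f := by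
  rw [LL, Polynomial.lsum_apply]
  exact Polynomial.sum_monomial_index _ _ (by simp)

def c0 : VY →ₗ[F] SymA := (Polynomial.lcoeff SymA 0).restrictScalars F
def cC : SymA →ₗ[F] VY := (Polynomial.monomial 0).restrictScalars F

lemma c0_apply (G : VY) : c0 G = G.coeff 0 := rfl
lemma cC_apply (f : SymA) : cC f = Polynomial.monomial 0 f := rfl

/-- the operators diagonal on Jack polynomials -/
def UU (e : F) (k : ℕ) : SymA →ₗ[F] SymA := c0 ∘ₗ ((LL e) ^ k) ∘ₗ cC

def pairY (B : SymA →ₗ[F] SymA →ₗ[F] F) : VY →ₗ[F] VY →ₗ[F] F :=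
  Polynomial.lsum (fun m => B.compl₂ ((Polynomial.lcoeff SymA m).restrictScalars F))

lemma pairY_left (B : SymA →ₗ[F] SymA →ₗ[F] F) (m : ℕ) (f : SymA) (H : VY) :
    pairY B (Polynomial.monomial m f) H = B f (H.coeff m) := by
  rw [pairY, Polynomial.lsum_apply, Polynomial.sum_monomial_index _ _ (by simp)]
  rfl

lemma vy_ext {M : Type*} [AddCommMonoid M] [Module F M] {A B : VY →ₗ[F] M}
    (h : ∀ m f, A (Polynomial.monomial m f) = B (Polynomial.monomial m f)) : A = B := by
  ext G
  induction G using Polynomial.induction_on' with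
  | add p q hp hq => rw [map_add, map_add, hp, hq]
  | monomial n a => exact h n a

lemma pairY_right (B : SymA →ₗ[F] SymA →ₗ[F] F) (m : ℕ) (f : SymA) (H : VY) :
    pairY B H (Polynomial.monomial m f) = B (H.coeff m) f := by
  have : (pairY B).flip (Polynomial.monomial m f)
    = (B.flip f) ∘ₗ ((Polynomial.lcoeff SymA m).restrictScalars F) := by
    refine vy_ext fun l g => ?_
    simp only [LinearMap.flip_apply, pairY_left, LinearMap.comp_apply,
      LinearMap.restrictScalars_apply, Polynomial.lcoeff_apply, Polynomial.coeff_monomial]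
    by_cases h : m = l
    · simp [h]
    · simp [h, Ne.symm h]
  exact LinearMap.congr_fun this H

structure AdjB (e : F) (B : SymA →ₗ[F] SymA →ₗ[F] F) : Prop where
  h1 : ∀ t a f, B (pp t * a) f = B a (dd t f + if t = 1 then e • f else 0)
  h2 : ∀ t a f, B (dd t a) f = B a (pp t * f)

lemma LL_adj {e : F} {B : SymA →ₗ[F] SymA →ₗ[F] F} (hB : AdjB e B) (G H : VY) :
    pairY B (LL 0 G) H = pairY B G (LL e H) := by
  have : (pairY B) ∘ₗ (LL 0) = (pairY B).compl₂ (LL e) := by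
    refine vy_ext fun m f => vy_ext fun l g => ?_
    simp only [LinearMap.comp_apply, LinearMap.compl₂_apply, LL_monomial, pairY_left, pairY_right,
      coeff_Lmon, map_add, LinearMap.add_apply, hB.h1, hB.h2]
    have h1 : (if m - l = 1 then e • g else 0) = (if m = l + 1 then e • g else 0) := by
      by_cases h : m = l + 1
      · simp [h]
      · rw [if_neg h, if_neg (by omega)]
    have h2 : B (if l = m then ((alpha - 1) * (m : F)) • f else 0) g
        = B f (if m = l then ((alpha - 1) * (l : F)) • g else 0) := by
      by_cases h : m = l
      · subst h; simp
      · simp [h, Ne.symm h]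
    rw [h1, h2]
    simp
    ring
  exact LinearMap.congr_fun (LinearMap.congr_fun this G) H

lemma LL_pow_adj {e : F} {B : SymA →ₗ[F] SymA →ₗ[F] F} (hB : AdjB e B) (k : ℕ) (G H : VY) :
    pairY B (((LL 0) ^ k) G) H = pairY B G (((LL e) ^ k) H) := by
  induction k generalizing G H with
  | zero => simp
  | succ k ih =>
    rw [pow_succ', pow_succ, Module.End.mul_apply, Module.End.mul_apply, LL_adj hB, ih]

lemma UU_adj {e : F} {B : SymA →ₗ[F] SymA →ₗ[F] F} (hB : AdjB e B) (k : ℕ) (f g : SymA) :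
    B (UU 0 k f) g = B f (UU e k g) := by
  have := LL_pow_adj hB k (cC f) (cC g)
  rw [cC_apply g, pairY_right, cC_apply f, pairY_left] at this
  exact this

lemma hall_AdjB : AdjB 0 hallL :=
  ⟨fun t a f => by simp [hall_adj1], fun t a f => hall_adj2 t a f⟩

/-! ### the shift `p_1 ↦ p_1 + 1` -/

def tau : SymA →ₐ[F] SymA := aeval (fun k : ℕ+ => X k + if k = 1 then 1 else 0)

lemma tau_pp (t : ℕ) : tau (pp t) = pp t + if t = 1 then 1 else 0 := by
  rcases Nat.eq_zero_or_pos t with rfl | ht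
  · simp [pp_zero]
  obtain ⟨t, rfl⟩ : ∃ t' : ℕ+, t = t' := ⟨⟨t, ht⟩, rfl⟩
  simp [pp_pnat, tau]

lemma tau_pderiv (i : ℕ+) (f : SymA) : tau (pderiv i f) = pderiv i (tau f) := by
  induction f using MvPolynomial.induction_on with
  | C a => simp [tau]
  | add p q hp hq => simp [hp, hq]
  | mul_X p j hp =>
    have h : tau (pderiv i (X j : SymA)) = pderiv i (tau (X j)) := by
      by_cases h : j = i
      · subst h
        by_cases h1 : j = 1 <;> simp [tau, h1]
      · rw [pderiv_X_of_ne h, map_zero, tau, aeval_X, map_add, pderiv_X_of_ne h]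
        split_ifs <;> simp
    simp only [pderiv_mul, map_add, map_mul, hp, h]

lemma tau_dd (t : ℕ) (f : SymA) : tau (dd t f) = dd t (tau f) := by
  rcases Nat.eq_zero_or_pos t with rfl | ht
  · simp [dd_zero]
  obtain ⟨t, rfl⟩ : ∃ t' : ℕ+, t = t' := ⟨⟨t, ht⟩, rfl⟩
  rw [dd_pnat, dd_pnat, map_smul, tau_pderiv]

/-- the shifted pairing -/
def hall1 : SymA →ₗ[F] SymA →ₗ[F] F := hallL ∘ₗ tau.toLinearMap

lemma hall1_apply (a f : SymA) : hall1 a f = hallL (tau a) f := rfl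

lemma hall1_AdjB : AdjB 1 hall1 := by
  refine ⟨fun t a f => ?_, fun t a f => ?_⟩
  · rw [hall1_apply, hall1_apply, map_mul, tau_pp, add_mul, map_add, LinearMap.add_apply,
      hall_adj1, map_add]
    congr 1
    split_ifs <;> simp
  · rw [hall1_apply, hall1_apply, tau_dd, hall_adj2]

/-- coefficients of the shift -/
lemma tau_monomial (m : Exp) : tau (monomial m 1) =
    ∑ j ∈ Finset.range (m 1 + 1), monomial (m.erase 1 + Finsupp.single 1 j)
      ((Nat.choose (m 1) j : ℕ) : F) := by
  have h1 : (monomial m (1 : F)) = monomial (m.erase 1) 1 * X 1 ^ (m 1) := by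
    rw [X_pow_eq_monomial, monomial_mul, mul_one, Finsupp.erase_add_single]
  have h2 : tau (monomial (m.erase 1) (1 : F)) = monomial (m.erase 1) 1 := by
    rw [tau, aeval_monomial, monomial_eq, map_one, C_1]
    congr 1
    refine Finsupp.prod_congr fun i hi => ?_
    have : i ≠ 1 := by
      rintro rfl
      simp at hi
    simp [this]
  have h3 : tau (X 1) = (X 1 + 1 : SymA) := by simp [tau]
  rw [h1, map_mul, h2, map_pow, h3, add_pow, Finset.mul_sum]
  refine Finset.sum_congr rfl fun j _ => ?_
  rw [one_pow, mul_one, X_pow_eq_monomial, ← mul_assoc, monomial_mul, mul_one,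
    ← C_eq_coe_nat, mul_comm, C_mul_monomial, mul_one]

end JA

namespace JA

open MvPolynomial

/-! ### Filtrations -/

def Fil (d : ℤ) : Submodule F SymA where
  carrier := {f | ∀ m, coeff m f ≠ 0 → (wt m : ℤ) ≤ d}
  zero_mem' := by intro m; simp
  add_mem' := by
    intro f g hf hg m h
    by_cases h1 : coeff m f = 0
    · refine hg m fun h2 => h ?_
      rw [coeff_add, h1, h2, add_zero]
    · exact hf m h1
  smul_mem' := by
    intro c f hf m h
    refine hf m fun h2 => h ?_
    rw [coeff_smul, h2, smul_zero]

lemma mem_Fil {d : ℤ} {f : SymA} : f ∈ Fil d ↔ ∀ m, coeff m f ≠ 0 → (wt m : ℤ) ≤ d := Iff.rfl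

lemma Fil_mono {d d' : ℤ} (h : d ≤ d') {f : SymA} (hf : f ∈ Fil d) : f ∈ Fil d' :=
  fun m hm => (hf m hm).trans h

lemma monomial_mem_Fil {m : Exp} {c : F} {d : ℤ} (h : (wt m : ℤ) ≤ d) : monomial m c ∈ Fil d := by
  intro n hn
  rw [coeff_monomial] at hn
  split_ifs at hn with h1
  · rwa [← h1]
  · exact absurd rfl hn

lemma Fil_mul {a b : ℤ} {f g : SymA} (hf : f ∈ Fil a) (hg : g ∈ Fil b) : f * g ∈ Fil (a + b) := by
  intro m hm
  rw [coeff_mul] at hm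
  obtain ⟨x, hx, hne⟩ := Finset.exists_ne_zero_of_sum_ne_zero hm
  have h1 := hf _ (left_ne_zero_of_mul hne)
  have h2 := hg _ (right_ne_zero_of_mul hne)
  rw [Finset.HasAntidiagonal.mem_antidiagonal] at hx
  rw [← hx, wt_add]
  push_cast
  omega

lemma pp_mem (t : ℕ) : pp t ∈ Fil t := by
  rcases Nat.eq_zero_or_pos t with rfl | ht
  · simp [pp_zero]
  obtain ⟨t, rfl⟩ : ∃ t' : ℕ+, t = t' := ⟨⟨t, ht⟩, rfl⟩
  rw [pp_pnat]
  exact monomial_mem_Fil (by simp [wt_single])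

lemma dd_mem (t : ℕ) {a : ℤ} {f : SymA} (hf : f ∈ Fil a) : dd t f ∈ Fil (a - t) := by
  rcases Nat.eq_zero_or_pos t with rfl | ht
  · simp [dd_zero]
  obtain ⟨t, rfl⟩ : ∃ t' : ℕ+, t = t' := ⟨⟨t, ht⟩, rfl⟩
  rw [dd_pnat]
  refine Submodule.smul_mem _ _ fun m hm => ?_
  rw [coeff_pderiv] at hm
  have := hf _ (left_ne_zero_of_mul hm)
  rw [wt_add, wt_single] at this
  push_cast at this
  omega

def FilY (d : ℤ) : Submodule F VY where
  carrier := {G | ∀ n : ℕ, G.coeff n ∈ Fil (d - n)}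
  zero_mem' := by intro n; simp
  add_mem' := by
    intro f g hf hg n
    rw [Polynomial.coeff_add]
    exact add_mem (hf n) (hg n)
  smul_mem' := by
    intro c f hf n
    rw [Polynomial.coeff_smul]
    exact Submodule.smul_mem _ _ (hf n)

lemma FilY_mono {d d' : ℤ} (h : d ≤ d') {f : VY} (hf : f ∈ FilY d) : f ∈ FilY d' :=
  fun n => Fil_mono (by omega) (hf n)

lemma FilY_mul {a b : ℤ} {f g : VY} (hf : f ∈ FilY a) (hg : g ∈ FilY b) : f * g ∈ FilY (a + b) := by
  intro n
  rw [Polynomial.coeff_mul]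
  refine Submodule.sum_mem _ fun x hx => ?_
  rw [Finset.HasAntidiagonal.mem_antidiagonal] at hx
  refine Fil_mono ?_ (Fil_mul (hf x.1) (hg x.2))
  omega

lemma one_mem_Fil : (1 : SymA) ∈ Fil 0 := by
  have : (1 : SymA) = monomial 0 1 := rfl
  rw [this]
  exact monomial_mem_Fil (by simp [wt])

lemma monomialY_mem {m : ℕ} {f : SymA} {d : ℤ} (hf : f ∈ Fil (d - m)) :
    (Polynomial.monomial m f : VY) ∈ FilY d := by
  intro n
  rw [Polynomial.coeff_monomial]
  split_ifs with h
  · rwa [← h]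
  · exact zero_mem _

lemma X_pow_mem (j : ℕ) : (Polynomial.X ^ j : VY) ∈ FilY j := by
  rw [Polynomial.X_pow_eq_monomial]
  exact monomialY_mem (by simpa using one_mem_Fil)

lemma X_mem : (Polynomial.X : VY) ∈ FilY 1 := by simpa using X_pow_mem 1

lemma C_mem {f : SymA} {d : ℤ} (hf : f ∈ Fil d) : (Polynomial.C f : VY) ∈ FilY d :=
  monomialY_mem (by simpa using hf)

lemma nabla_mem {f : SymA} {d : ℤ} (hf : f ∈ Fil d) : nabla f ∈ FilY d := by
  intro n
  rw [coeff_nabla]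
  exact dd_mem n hf

lemma LL0_mem {G : VY} {d : ℤ} (hG : G ∈ FilY d) : LL 0 G ∈ FilY d := by
  rw [LL, Polynomial.lsum_apply, Polynomial.sum]
  refine Submodule.sum_mem _ fun m _ => fun l => ?_
  have hm := hG m
  rw [coeff_Lmon]
  refine add_mem (add_mem (add_mem ?_ ?_) ?_) ?_
  · rcases le_or_gt m l with h | h
    · refine Fil_mono ?_ (dd_mem (l - m) hm)
      push_cast [h]; omega
    · rw [show l - m = 0 by omega, dd_zero]
      exact zero_mem _
  · simp
  · split_ifs with h
    · rw [h]; exact Submodule.smul_mem _ _ hm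
    · exact zero_mem _
  · rcases le_or_gt l m with h | h
    · refine Fil_mono ?_ (Fil_mul (pp_mem (m - l)) hm)
      push_cast [h]; omega
    · rw [show m - l = 0 by omega, pp_zero, zero_mul]
      exact zero_mem _

lemma LL1_eq (G : VY) : LL 1 G = LL 0 G + Polynomial.X * G := by
  have : LL 1 = LL 0 + LinearMap.mulLeft F (Polynomial.X : VY) := by
    refine vy_ext fun m f => ?_
    rw [LinearMap.add_apply, LL_monomial, LL_monomial, Lmon_apply, Lmon_apply,
      LinearMap.mulLeft_apply, Polynomial.X_mul_monomial]
    simp only [one_smul, zero_smul]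
    abel
  rw [this]; rfl

lemma LL1_mem {G : VY} {d : ℤ} (hG : G ∈ FilY d) : LL 1 G ∈ FilY (d + 1) := by
  rw [LL1_eq]
  refine add_mem (FilY_mono (by omega) (LL0_mem hG)) ?_
  rw [add_comm d]
  exact FilY_mul X_mem hG

lemma LL_mul (e : F) (f : SymA) (G : VY) :
    LL e (Polynomial.C f * G) = Polynomial.C f * LL e G + nabla f * G := by
  have : LL e ∘ₗ LinearMap.mulLeft F (Polynomial.C f : VY)
      = LinearMap.mulLeft F (Polynomial.C f : VY) ∘ₗ LL e + LinearMap.mulLeft F (nabla f) := by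
    refine vy_ext fun m g => ?_
    simp only [LinearMap.add_apply, LinearMap.comp_apply, LinearMap.mulLeft_apply,
      Polynomial.C_mul_monomial, LL_monomial, Lmon_apply]
    rw [Derivation.leibniz, mul_add, mul_add, mul_add, Finset.mul_sum, mul_smul_comm,
      mul_smul_comm, Polynomial.C_mul_monomial, Polynomial.C_mul_monomial,
      Polynomial.smul_eq_C_mul, Polynomial.smul_eq_C_mul, ← Polynomial.C_mul_X_pow_eq_monomial
        (n := m) (a := g)]
    have : ∀ t ∈ Finset.range m, (Polynomial.monomial (m - 1 - t)) (pp (t + 1) * (f * g)) =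
        Polynomial.C f * Polynomial.monomial (m - 1 - t) (pp (t + 1) * g) := by
      intro t _
      rw [Polynomial.C_mul_monomial]
      congr 1
      ring
    rw [Finset.sum_congr rfl this]
    ring
  exact LinearMap.congr_fun this G

def ppi : VY →ₗ[SymA] SymA := Polynomial.lsum (fun m => LinearMap.mulRight SymA (pp m))
def ppi' : VY →ₗ[SymA] SymA := Polynomial.lsum (fun m => LinearMap.mulRight SymA (pp (m - 1)))

lemma ppi_monomial (m : ℕ) (f : SymA) : ppi (Polynomial.monomial m f) = f * pp m := by
  rw [ppi, Polynomial.lsum_apply, Polynomial.sum_monomial_index _ _ (by simp)]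
  simp

lemma ppi'_monomial (m : ℕ) (f : SymA) : ppi' (Polynomial.monomial m f) = f * pp (m - 1) := by
  rw [ppi', Polynomial.lsum_apply, Polynomial.sum_monomial_index _ _ (by simp)]
  simp

lemma c0_LL (e : F) (G : VY) : c0 (LL e G) = ppi G := by
  have : c0 ∘ₗ LL e = ppi.restrictScalars F := by
    refine vy_ext fun m f => ?_
    rw [LinearMap.comp_apply, LinearMap.restrictScalars_apply, ppi_monomial, LL_monomial, c0_apply,
      coeff_Lmon]
    rcases Nat.eq_zero_or_pos m with rfl | h
    · simp [dd_zero, pp_zero]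
    · have : 0 ≠ m := by omega
      simp [dd_zero, this, mul_comm]
  exact LinearMap.congr_fun this G

lemma ppi_mem {G : VY} {d : ℤ} (hG : G ∈ FilY d) : ppi G ∈ Fil d := by
  rw [ppi, Polynomial.lsum_apply, Polynomial.sum]
  refine Submodule.sum_mem _ fun m _ => ?_
  exact Fil_mono (by omega) (Fil_mul (hG m) (pp_mem m))

lemma ppi'_mem {G : VY} {d : ℤ} (hG : G ∈ FilY d) : ppi' G ∈ Fil (d - 1) := by
  rw [ppi', Polynomial.lsum_apply, Polynomial.sum]
  refine Submodule.sum_mem _ fun m _ => ?_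
  rcases Nat.eq_zero_or_pos m with rfl | h
  · simp [pp_zero]
  · refine Fil_mono ?_ (Fil_mul (hG m) (pp_mem (m - 1)))
    push_cast [h]; omega

lemma ppi'_X_mul (G : VY) : ppi' (Polynomial.X * G) = ppi G := by
  have : (ppi'.restrictScalars F) ∘ₗ LinearMap.mulLeft F (Polynomial.X : VY)
      = ppi.restrictScalars F := by
    refine vy_ext fun m f => ?_
    simp [ppi_monomial, Polynomial.X_mul_monomial, ppi'_monomial]
  exact LinearMap.congr_fun this G

/-- first order term of the product of Jack characters -/
def BB (f g : SymA) : SymA := alpha⁻¹ • ppi' (nabla f * nabla g)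

lemma BB_mem {a b : ℤ} {f g : SymA} (hf : f ∈ Fil a) (hg : g ∈ Fil b) :
    BB f g ∈ Fil (a + b - 1) :=
  Submodule.smul_mem _ _ (ppi'_mem (FilY_mul (nabla_mem hf) (nabla_mem hg)))

lemma BB_add_left (f f' g : SymA) : BB (f + f') g = BB f g + BB f' g := by
  simp [BB, add_mul]
lemma BB_add_right (f g g' : SymA) : BB f (g + g') = BB f g + BB f g' := by
  simp [BB, mul_add]
lemma BB_smul_left (c : F) (f g : SymA) : BB (c • f) g = c • BB f g := by
  rw [BB, Derivation.map_smul, smul_mul_assoc, LinearMap.map_smul_of_tower, smul_comm, BB]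
lemma BB_comm (f g : SymA) : BB f g = BB g f := by
  simp [BB, mul_comm]
lemma BB_smul_right (c : F) (f g : SymA) : BB f (c • g) = c • BB f g := by
  rw [BB_comm, BB_smul_left, BB_comm]
lemma BB_mul_left (f f' g : SymA) : BB (f * f') g = f * BB f' g + f' * BB f g := by
  simp only [BB, Derivation.leibniz, add_mul, smul_mul_assoc, map_add, map_smul, smul_add,
    smul_eq_mul, mul_smul_comm]
lemma BB_mul_right (f g g' : SymA) : BB f (g * g') = g * BB f g' + g' * BB f g := by
  rw [BB_comm, BB_mul_left, BB_comm g', BB_comm g]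
lemma BB_one_left (g : SymA) : BB 1 g = 0 := by
  simp [BB]
lemma BB_zero_left (g : SymA) : BB 0 g = 0 := by
  simp [BB]

lemma BB_pp (k : ℕ) (f : SymA) :
    BB (pp (k + 1)) f = ((k + 1 : ℕ) : F) • ppi (Polynomial.X ^ k * nabla f) := by
  have h : nabla (pp (k + 1)) = (alpha * ((k + 1 : ℕ) : F)) • (Polynomial.X ^ (k + 1) : VY) := by
    have := nabla_X (Nat.toPNat (k + 1) (by omega))
    rw [← pp_pnat] at this
    exact this
  rw [BB, h, smul_mul_assoc, pow_succ', mul_assoc, LinearMap.map_smul_of_tower, ppi'_X_mul, smul_smul]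
  congr 1
  rw [← mul_assoc, inv_mul_cancel₀ alpha_ne_zero, one_mul]

lemma LLpow_one (j : ℕ) : ((LL 1) ^ j) (1 : VY) - Polynomial.X ^ j ∈ FilY (j - 1) := by
  induction j with
  | zero => simp
  | succ j ih =>
    rw [pow_succ', Module.End.mul_apply]
    have h : (LL 1) (((LL 1) ^ j) (1 : VY)) - Polynomial.X ^ (j + 1)
        = LL 1 (((LL 1) ^ j) (1 : VY) - Polynomial.X ^ j) + LL 0 (Polynomial.X ^ j) := by
      rw [map_sub, LL1_eq (Polynomial.X ^ j), pow_succ']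
      abel
    rw [h]
    refine add_mem (FilY_mono ?_ (LL1_mem ih)) (FilY_mono ?_ (LL0_mem (X_pow_mem j))) <;>
    · push_cast; omega

lemma LLpow_C {b : ℤ} {f : SymA} (hf : f ∈ Fil b) (j : ℕ) :
    ((LL 1) ^ j) (Polynomial.C f) - Polynomial.C f * ((LL 1) ^ j) 1
      - (j : F) • (Polynomial.X ^ (j - 1) * nabla f) ∈ FilY (b + j - 2) := by
  induction j with
  | zero => simp
  | succ j ih =>
    have hx : (j : F) • (Polynomial.X * (Polynomial.X ^ (j - 1) * nabla f))
        = (j : F) • (Polynomial.X ^ j * nabla f) := by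
      rcases Nat.eq_zero_or_pos j with rfl | h
      · simp
      · obtain ⟨i, rfl⟩ : ∃ i, j = i + 1 := ⟨j - 1, by omega⟩
        rw [Nat.add_sub_cancel, pow_succ', mul_assoc]
    have h : ((LL 1) ^ (j + 1)) (Polynomial.C f) - Polynomial.C f * ((LL 1) ^ (j + 1)) 1
      - ((j + 1 : ℕ) : F) • (Polynomial.X ^ (j + 1 - 1) * nabla f)
      = LL 1 (((LL 1) ^ j) (Polynomial.C f) - Polynomial.C f * ((LL 1) ^ j) 1
          - (j : F) • (Polynomial.X ^ (j - 1) * nabla f))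
        + nabla f * (((LL 1) ^ j) 1 - Polynomial.X ^ j)
        + (j : F) • LL 0 (Polynomial.X ^ (j - 1) * nabla f) := by
      rw [pow_succ', Module.End.mul_apply, Module.End.mul_apply, map_sub, map_sub, map_smul,
        LL_mul, LL1_eq (Polynomial.X ^ (j - 1) * nabla f), smul_add, hx, Nat.add_sub_cancel]
      push_cast
      rw [add_smul, one_smul]
      ring
    rw [h]
    refine add_mem (add_mem (FilY_mono ?_ (LL1_mem ih))
      (FilY_mono ?_ (FilY_mul (nabla_mem hf) (LLpow_one j)))) ?_
    · push_cast; omega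
    · push_cast; omega
    · rcases Nat.eq_zero_or_pos j with rfl | h
      · simp
      · refine Submodule.smul_mem _ _ (FilY_mono ?_
          (LL0_mem (FilY_mul (X_pow_mem (j - 1)) (nabla_mem hf))))
        push_cast [h]; omega

lemma UU_succ (k : ℕ) (f : SymA) : UU 1 (k + 1) f = ppi (((LL 1) ^ k) (Polynomial.C f)) := by
  have : UU 1 (k + 1) f = c0 (((LL 1) ^ (k + 1)) (Polynomial.C f)) := rfl
  rw [this, pow_succ', Module.End.mul_apply, c0_LL]

lemma UU_one_mem (k : ℕ) : UU 1 (k + 1) 1 - pp k ∈ Fil (k - 1) := by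
  have h1 : pp k = ppi (Polynomial.X ^ k) := by
    rw [Polynomial.X_pow_eq_monomial, ppi_monomial, one_mul]
  rw [UU_succ, h1, ← map_sub, Polynomial.C_1]
  exact ppi_mem (LLpow_one k)

lemma UU_key {b : ℤ} {f : SymA} (hf : f ∈ Fil b) {k : ℕ} (hk : 0 < k) :
    UU 1 (k + 1) f - UU 1 (k + 1) 1 * f - BB (UU 1 (k + 1) 1) f ∈ Fil (b + k - 2) := by
  obtain ⟨i, rfl⟩ : ∃ i, k = i + 1 := ⟨k - 1, by omega⟩
  have h := ppi_mem (LLpow_C hf (i + 1))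
  have e1 := BB_pp i f
  have e2 : ppi (((i + 1 : ℕ) : F) • (Polynomial.X ^ (i + 1 - 1) * nabla f))
      = BB (pp (i + 1)) f := by
    rw [e1, LinearMap.map_smul_of_tower]
    rfl
  rw [map_sub, map_sub, e2, ← UU_succ, ← Polynomial.smul_eq_C_mul, map_smul, ← Polynomial.C_1,
    ← UU_succ] at h
  have h2 := BB_mem (UU_one_mem (i + 1)) hf
  have e3 : BB (UU 1 (i + 1 + 1) 1) f
      = BB (UU 1 (i + 1 + 1) 1 - pp (i + 1)) f + BB (pp (i + 1)) f := by
    rw [← BB_add_left, sub_add_cancel]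
  have e4 : UU 1 (i + 1 + 1) f - UU 1 (i + 1 + 1) 1 * f - BB (UU 1 (i + 1 + 1) 1) f
    = (UU 1 (i + 1 + 1) f - f • UU 1 (i + 1 + 1) 1 - BB (pp (i + 1)) f)
      - BB (UU 1 (i + 1 + 1) 1 - pp (i + 1)) f := by
    rw [e3, smul_eq_mul]
    ring
  rw [e4]
  exact sub_mem h (Fil_mono (by push_cast; omega) h2)

/-! ### the product theorem -/

section prod
variable {Lam : Type*} (Th : SymA →ₗ[F] (Lam → F))

def Good (a : ℤ) : Submodule F SymA where
  carrier := {f | ∀ (b : ℤ) (g : SymA), g ∈ Fil b → ∃ H : SymA, Th H = Th f * Th g ∧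
    H - f * g - BB f g ∈ Fil (a + b - 2)}
  zero_mem' := by
    intro b g _
    exact ⟨0, by simp, by simp [BB_zero_left]⟩
  add_mem' := by
    intro f f' hf hf' b g hg
    obtain ⟨H, h1, h2⟩ := hf b g hg
    obtain ⟨H', h1', h2'⟩ := hf' b g hg
    refine ⟨H + H', by rw [map_add, map_add, h1, h1', add_mul], ?_⟩
    have := add_mem h2 h2'
    rw [BB_add_left]
    convert this using 1
    ring
  smul_mem' := by
    intro c f hf b g hg
    obtain ⟨H, h1, h2⟩ := hf b g hg
    refine ⟨c • H, by rw [map_smul, map_smul, h1, smul_mul_assoc], ?_⟩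
    have := Submodule.smul_mem _ c h2
    rw [BB_smul_left, smul_mul_assoc, ← smul_sub, ← smul_sub]
    exact this

lemma Good_mono {a a' : ℤ} (h : a ≤ a') {f : SymA} (hf : f ∈ Good Th a) : f ∈ Good Th a' := by
  intro b g hg
  obtain ⟨H, h1, h2⟩ := hf b g hg
  exact ⟨H, h1, Fil_mono (by omega) h2⟩

lemma Fil_le_of_monomials {a : ℤ} {S : Submodule F SymA}
    (h : ∀ m : Exp, (wt m : ℤ) ≤ a → monomial m (1 : F) ∈ S) {f : SymA} (hf : f ∈ Fil a) :
    f ∈ S := by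
  rw [f.as_sum]
  refine Submodule.sum_mem _ fun m hm => ?_
  have : monomial m (coeff m f) = coeff m f • monomial m (1 : F) := by
    rw [smul_monomial, smul_eq_mul, mul_one]
  rw [this]
  exact Submodule.smul_mem _ _ (h m (hf m (mem_support_iff.1 hm)))

variable (hh : ℕ → Lam → F) (h1 : Th 1 = 1)
  (hU : ∀ k f, Th (UU 1 k f) = hh k * Th f)

theorem good_monomial (h1 : Th 1 = 1) (hU : ∀ k f, Th (UU 1 k f) = hh k * Th f) (n : ℕ) :
    ∀ m : Exp, wt m = n → monomial m (1 : F) ∈ Good Th n := by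
  induction n using Nat.strong_induction_on with
  | _ n ih =>
  intro m hm
  by_cases hm0 : m = 0
  · subst hm0
    have hone : (monomial 0 (1 : F) : SymA) = 1 := rfl
    have hn : n = 0 := by rw [← hm]; simp [wt]
    intro b g hg
    refine ⟨g, by rw [hone, h1, one_mul], ?_⟩
    rw [hone, one_mul, BB_one_left]
    simp
  · obtain ⟨k, hk⟩ : ∃ k, m k ≠ 0 := by
      by_contra hcon
      push Not at hcon
      exact hm0 (Finsupp.ext hcon)
    have hmk : m = (m - Finsupp.single k 1) + Finsupp.single k 1 := by
      rw [tsub_add_cancel_of_le]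
      rw [Finsupp.single_le_iff]
      omega
    set m' := m - Finsupp.single k 1 with hm'
    have hwt : wt m' + k = n := by
      rw [← hm, hmk, wt_add, wt_single, one_mul]
    have hkp : 0 < (k : ℕ) := k.pos
    set f' : SymA := monomial m' (1 : F) with hf'
    have hfm : (monomial m (1 : F) : SymA) = pp k * f' := by
      rw [hmk, hf', pp_pnat, X, monomial_mul, one_mul, add_comm]
    have hfF : f' ∈ Fil (wt m') := monomial_mem_Fil le_rfl
    have hfG : f' ∈ Good Th (wt m') := ih (wt m') (by omega) m' rfl
    set u := UU 1 ((k : ℕ) + 1) 1 with hu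
    have hup : u - pp k ∈ Fil ((k : ℕ) - 1) := UU_one_mem k
    have huF : u ∈ Fil (k : ℕ) := by
      have := add_mem (Fil_mono (by omega) hup) (pp_mem (k : ℕ))
      rwa [sub_add_cancel] at this
    set w := UU 1 ((k : ℕ) + 1) f' with hw
    have he2 : w - u * f' - BB u f' ∈ Fil (wt m' + (k : ℕ) - 2) := UU_key hfF hkp
    have hlow : w - pp k * f' ∈ Good Th n := by
      have h3 : w - pp k * f' ∈ Fil ((n : ℤ) - 1) := by
        have := add_mem (add_mem (Fil_mono (d' := (n : ℤ) - 1) (by omega) he2)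
          (Fil_mono (d' := (n : ℤ) - 1) (by omega) (BB_mem huF hfF)))
          (Fil_mono (d' := (n : ℤ) - 1) (by omega) (Fil_mul hup hfF))
        convert this using 1
        ring
      refine Fil_le_of_monomials (fun q hq => ?_) h3
      exact Good_mono Th (by omega) (ih (wt q) (by omega) q rfl)
    have hwG : w ∈ Good Th n := by
      intro b g hg
      obtain ⟨H', e1, e2⟩ := hfG b g hg
      have hBfg := BB_mem hfF hg
      have hH' : H' ∈ Fil (wt m' + b) := by
        have := add_mem (add_mem (Fil_mono (d' := (wt m' : ℤ) + b) (by omega) e2)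
          (Fil_mono (d' := (wt m' : ℤ) + b) (by omega) hBfg)) (Fil_mul hfF hg)
        convert this using 1
        ring
      have e3 := UU_key hH' hkp
      rw [← hu] at e3
      refine ⟨UU 1 ((k : ℕ) + 1) H', ?_, ?_⟩
      · rw [hU, e1, hw, hU, mul_assoc]
      · set E' := H' - f' * g - BB f' g with hE'
        set E2 := w - u * f' - BB u f' with hE2
        have x1 : H' = f' * g + BB f' g + E' := by rw [hE']; ring
        have x2 : w = u * f' + BB u f' + E2 := by rw [hE2]; ring
        have x3 : UU 1 ((k : ℕ) + 1) H' - w * g - BB w g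
          = (UU 1 ((k : ℕ) + 1) H' - u * H' - BB u H') + u * E' + BB u (BB f' g) + BB u E'
            - E2 * g - BB (BB u f') g - BB E2 g := by
          have y1 : BB u H' = f' * BB u g + g * BB u f' + BB u (BB f' g) + BB u E' := by
            conv_lhs => rw [x1]
            rw [BB_add_right, BB_add_right, BB_mul_right]
          have y2 : BB w g = u * BB f' g + f' * BB u g + BB (BB u f') g + BB E2 g := by
            conv_lhs => rw [x2]
            rw [BB_add_left, BB_add_left, BB_mul_left]
          rw [y1, y2, hE', hE2]
          ring
        rw [x3]
        have D : ∀ {d : ℤ} {q : SymA}, q ∈ Fil d → d ≤ (n : ℤ) + b - 2 →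
            q ∈ Fil ((n : ℤ) + b - 2) := fun hq hd => Fil_mono hd hq
        refine sub_mem (sub_mem (sub_mem (add_mem (add_mem (add_mem ?_ ?_) ?_) ?_) ?_) ?_) ?_
        · exact D e3 (by omega)
        · exact D (Fil_mul huF e2) (by omega)
        · exact D (BB_mem huF hBfg) (by omega)
        · exact D (BB_mem huF e2) (by omega)
        · exact D (Fil_mul he2 hg) (by omega)
        · exact D (BB_mem (BB_mem huF hfF) hg) (by omega)
        · exact D (BB_mem he2 hg) (by omega)
    rw [hfm]
    have := sub_mem hwG hlow
    rwa [sub_sub_cancel] at this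

end prod

end JA

namespace JA

open MvPolynomial

/-! ### Partitions and dominance -/

lemma coe_map_eq (l : JPartition) :
    (l.map fun i => (i : ℕ)) = Multiset.map PNat.val l := by
  rw [Multiset.map_id']
  show Multiset.bind l (fun a => {(a : ℕ)}) = _
  rw [Multiset.bind_singleton]

lemma psize_eq (l : JPartition) : psize l = (Multiset.map PNat.val l).sum := by
  rw [psize, coe_map_eq]

/-- the `i`-th part (zero based) of a partition -/
def part (l : JPartition) (i : ℕ) : ℕ := (sortedParts l).getD i 0

lemma sum_take_getD (l : List ℕ) (k : ℕ) : (l.take k).sum = ∑ i ∈ Finset.range k, l.getD i 0 := by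
  induction l generalizing k with
  | nil => simp
  | cons a l ih =>
    cases k with
    | zero => simp
    | succ k =>
      rw [List.take_succ_cons, List.sum_cons, ih, Finset.sum_range_succ']
      simp [add_comm]

lemma topSum_eq (l : JPartition) (k : ℕ) : topSum l k = ∑ i ∈ Finset.range k, part l i :=
  sum_take_getD _ _

lemma getD_antitone {l : List ℕ} (h : l.Pairwise (· ≥ ·)) : Antitone (fun i => l.getD i 0) := by
  intro i j hij
  rcases eq_or_lt_of_le hij with rfl | hij
  · exact le_rfl
  by_cases hj : j < l.length
  · have hi : i < l.length := hij.trans hj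
    simp only [List.getD_eq_getElem _ _ hj, List.getD_eq_getElem _ _ hi]
    exact List.pairwise_iff_getElem.1 h i j hi hj hij
  · simp only [List.getD_eq_default _ _ (not_lt.1 hj)]
    exact Nat.zero_le _

lemma sortedParts_pairwise (l : JPartition) : (sortedParts l).Pairwise (· ≥ ·) := by
  rw [sortedParts, List.pairwise_reverse]
  exact Multiset.pairwise_sort _ _

lemma part_antitone (l : JPartition) : Antitone (part l) := getD_antitone (sortedParts_pairwise l)

lemma coe_sortedParts (l : JPartition) :
    (sortedParts l : Multiset ℕ) = Multiset.map PNat.val l := by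
  rw [sortedParts, coe_map_eq, Multiset.coe_reverse, Multiset.sort_eq]

lemma length_sortedParts (l : JPartition) : (sortedParts l).length = plen l := by
  rw [← Multiset.coe_card, coe_sortedParts, Multiset.card_map]; rfl

lemma sum_antitone_le {b : ℕ → ℕ} (hb : Antitone b) (I : Finset ℕ) :
    ∑ i ∈ I, b i ≤ ∑ i ∈ Finset.range I.card, b i := by
  induction I using Finset.induction_on_max with
  | empty => simp
  | insert m I hm ih =>
    have hmI : m ∉ I := fun h => lt_irrefl _ (hm m h)
    rw [Finset.sum_insert hmI, Finset.card_insert_of_notMem hmI, Finset.sum_range_succ, add_comm]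
    refine add_le_add ih (hb ?_)
    have : I ⊆ Finset.range m := fun x hx => Finset.mem_range.2 (hm x hx)
    simpa using Finset.card_le_card this

lemma xexp_apply (mu : JPartition) (N : ℕ) (j : Fin N) : xexp mu N j = part mu j := rfl

lemma getD_ofFn (l : List ℕ) (N : ℕ) (h : l.length ≤ N) :
    List.ofFn (fun j : Fin N => l.getD j 0) = l ++ List.replicate (N - l.length) 0 := by
  apply List.ext_getElem
  · simp [h]
  · intro i h1 h2
    rw [List.getElem_ofFn, List.getElem_append]
    split_ifs with h3
    · exact List.getD_eq_getElem _ _ h3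
    · rw [List.getElem_replicate]
      exact List.getD_eq_default _ _ (not_lt.1 h3)

lemma ofFn_xexp (mu : JPartition) (N : ℕ) (h : plen mu ≤ N) :
    List.ofFn (fun j => xexp mu N j) = sortedParts mu ++ List.replicate (N - plen mu) 0 := by
  rw [← length_sortedParts] at h ⊢
  exact getD_ofFn _ _ h

lemma sum_xexp (mu : JPartition) (N : ℕ) (h : plen mu ≤ N) : ∑ j, xexp mu N j = psize mu := by
  rw [← List.sum_ofFn, ofFn_xexp mu N h, List.sum_append, ← Multiset.sum_coe (sortedParts mu),
    coe_sortedParts]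
  simp [psize_eq]

lemma xexp_inj {mu nu : JPartition} {N : ℕ} (h : plen mu ≤ N) (h' : plen nu ≤ N)
    (he : xexp mu N = xexp nu N) : mu = nu := by
  have key : ∀ mu : JPartition, plen mu ≤ N →
      Multiset.map PNat.val mu =
        Multiset.filter (fun i => i ≠ 0) (List.ofFn (fun j => xexp mu N j) : Multiset ℕ) := by
    intro mu h
    rw [ofFn_xexp mu N h, ← Multiset.coe_add, Multiset.filter_add, coe_sortedParts,
      Multiset.filter_eq_self.2, Multiset.filter_eq_nil.2, add_zero]
    · intro a ha
      simp only [Multiset.mem_coe, List.mem_replicate] at ha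
      simp [ha.2]
    · intro a ha
      obtain ⟨b, _, rfl⟩ := Multiset.mem_map.1 ha
      exact b.ne_zero
  have := key mu h
  rw [he, ← key nu h'] at this
  exact Multiset.map_injective PNat.coe_injective this

lemma exists_perm_xexp {N : ℕ} (a : Fin N →₀ ℕ) :
    ∃ mu : JPartition, plen mu ≤ N ∧ ∃ s : Equiv.Perm (Fin N), a = (xexp mu N).mapDomain s := by
  have hpos : ∀ x ∈ Multiset.filter (fun i => 0 < i) (List.ofFn (fun j => a j) : Multiset ℕ),
      0 < x := fun x hx => (Multiset.mem_filter.1 hx).2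
  obtain ⟨mu, hmu⟩ : ∃ mu : JPartition, Multiset.map PNat.val mu =
      Multiset.filter (fun i => 0 < i) (List.ofFn (fun j => a j) : Multiset ℕ) := by
    refine ⟨(Multiset.filter (fun i => 0 < i) (List.ofFn (fun j => a j) : Multiset ℕ)).map
      Nat.toPNat', ?_⟩
    rw [Multiset.map_map]
    conv_rhs => rw [← Multiset.map_id (Multiset.filter _ _)]
    refine Multiset.map_congr rfl fun x hx => ?_
    simp [Nat.toPNat'_coe, hpos x hx]
  have hle : plen mu ≤ N := by
    have := congrArg Multiset.card hmu
    rw [Multiset.card_map] at this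
    rw [plen, this]
    refine (Multiset.card_le_card (Multiset.filter_le _ _)).trans ?_
    simp
  refine ⟨mu, hle, ?_⟩
  have hperm : (List.ofFn (fun j => a j)).Perm (List.ofFn (fun j => xexp mu N j)) := by
    rw [← Multiset.coe_eq_coe, ofFn_xexp mu N hle, ← Multiset.coe_add, coe_sortedParts, hmu]
    conv_lhs => rw [← Multiset.filter_add_not (fun i => 0 < i) (List.ofFn (fun j => a j) : Multiset ℕ)]
    congr 1
    have h0 : ∀ x ∈ Multiset.filter (fun i => ¬ 0 < i)
      (List.ofFn (fun j => a j) : Multiset ℕ), x = 0 := fun x hx => by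
        have := (Multiset.mem_filter.1 hx).2; omega
    rw [Multiset.eq_replicate_of_mem h0, Multiset.coe_replicate]
    congr 2
    have h1 := congrArg Multiset.card (Multiset.filter_add_not (fun i => 0 < i)
      (List.ofFn (fun j => a j) : Multiset ℕ))
    rw [Multiset.card_add, ← hmu, Multiset.card_map, Multiset.coe_card, List.length_ofFn] at h1
    rw [plen]
    omega
  set f : Fin N → ℕ := fun j => a j
  set g : Fin N → ℕ := fun j => xexp mu N j
  have h1 : f ∘ Tuple.sort f = g ∘ Tuple.sort g := by
    apply List.ofFn_injective
    refine List.Perm.eq_of_pairwise' (r := (· ≤ ·)) ?_ ?_ ?_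
    · exact List.pairwise_ofFn.2 fun x y h => Tuple.monotone_sort f h.le
    · exact List.pairwise_ofFn.2 fun x y h => Tuple.monotone_sort g h.le
    · exact ((Tuple.sort f).ofFn_comp_perm f).trans (hperm.trans
        ((Tuple.sort g).ofFn_comp_perm g).symm)
  refine ⟨(Tuple.sort g).symm.trans (Tuple.sort f), ?_⟩
  ext j
  rw [Finsupp.mapDomain_equiv_apply]
  have := congrFun h1 ((Tuple.sort f).symm j)
  simpa [f, g] using this

lemma dominates_refl (l : JPartition) : dominates l l := ⟨rfl, fun _ => le_rfl⟩

lemma part_eq_zero {l : JPartition} {i : ℕ} (h : plen l ≤ i) : part l i = 0 :=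
  List.getD_eq_default _ _ (by rwa [length_sortedParts])

lemma dominates_antisymm {l m : JPartition} (h1 : dominates l m) (h2 : dominates m l) : l = m := by
  have h : ∀ k, topSum l k = topSum m k := fun k => le_antisymm (h1.2 k) (h2.2 k)
  have hp : ∀ k, part l k = part m k := by
    intro k
    have a := h k
    have b := h (k + 1)
    rw [topSum_eq, topSum_eq] at a b
    rw [Finset.sum_range_succ, Finset.sum_range_succ] at b
    omega
  refine xexp_inj (N := plen l + plen m) (by omega) (by omega) ?_
  ext j
  rw [xexp_apply, xexp_apply, hp]

lemma finite_psize_le (n : ℕ) : {m : JPartition | psize m ≤ n}.Finite := by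
  refine Set.Finite.subset (Set.finite_Iic (∑ i ∈ Finset.Icc 1 (Nat.succPNat n),
    Multiset.replicate n i)) ?_
  intro m hm
  rw [Set.mem_Iic, Multiset.le_iff_count]
  intro i
  by_cases hi : i ∈ m
  · have h1 : Multiset.count i m * (i : ℕ) ≤ psize m := by
      have h2 : Multiset.replicate (Multiset.count i m) i ≤ m :=
        Multiset.le_count_iff_replicate_le.1 le_rfl
      obtain ⟨u, hu⟩ := Multiset.le_iff_exists_add.1 h2
      conv_rhs => rw [psize_eq, hu, Multiset.map_add, Multiset.sum_add, Multiset.map_replicate,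
        Multiset.sum_replicate, smul_eq_mul]
      omega
    have hm' : psize m ≤ n := hm
    have hc : 0 < Multiset.count i m := Multiset.count_pos.2 hi
    have hip := i.pos
    have h3 : (i : ℕ) ≤ n := by nlinarith
    have h4 : Multiset.count i m ≤ n := by nlinarith
    rw [Multiset.count_sum']
    refine h4.trans ?_
    have : i ∈ Finset.Icc 1 (Nat.succPNat n) := by
      rw [Finset.mem_Icc]
      refine ⟨one_le, ?_⟩
      rw [← PNat.coe_le_coe]
      simp; omega
    refine le_trans ?_ (Finset.single_le_sum (f := fun x => Multiset.count i (Multiset.replicate n x)) (fun _ _ => Nat.zero_le _) this)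
    simp
  · rw [Multiset.count_eq_zero_of_notMem hi]
    exact Nat.zero_le _

/-- generalized dominance for exponent vectors -/
def Dom {N : ℕ} (lam : JPartition) (a : Fin N →₀ ℕ) : Prop :=
  ∑ i, a i = psize lam ∧ ∀ I : Finset (Fin N), ∑ i ∈ I, a i ≤ topSum lam I.card

lemma Dom_xexp {mu lam : JPartition} {N : ℕ} (h : plen mu ≤ N) (hd : dominates mu lam) :
    Dom lam (xexp mu N) := by
  refine ⟨by rw [sum_xexp mu N h, hd.1], fun I => ?_⟩
  refine le_trans ?_ (hd.2 _)
  rw [topSum_eq]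
  have := sum_antitone_le (part_antitone mu) (I.map Fin.valEmbedding)
  rw [Finset.sum_map, Finset.card_map] at this
  exact this

lemma dominates_of_Dom {mu lam : JPartition} (hd : Dom lam (xexp mu (plen mu))) :
    dominates mu lam := by
  refine ⟨by rw [← hd.1, sum_xexp mu _ le_rfl], fun k => ?_⟩
  have key : ∀ k ≤ plen mu, topSum mu k ≤ topSum lam k := by
    intro k hk
    have h := hd.2 (Finset.univ.map (Fin.castLEEmb hk))
    rw [Finset.sum_map, Finset.card_map, Finset.card_univ, Fintype.card_fin] at h
    refine le_trans (le_of_eq ?_) h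
    rw [topSum_eq, Finset.sum_range]
    rfl
  rcases le_or_gt k (plen mu) with hk | hk
  · exact key k hk
  · have h1 : topSum mu k = topSum mu (plen mu) := by
      rw [topSum_eq, topSum_eq]
      symm
      refine Finset.sum_subset (Finset.range_mono hk.le) fun x _ hx => ?_
      exact part_eq_zero (by simpa using hx)
    rw [h1]
    refine (key _ le_rfl).trans ?_
    rw [topSum_eq, topSum_eq]
    exact Finset.sum_le_sum_of_subset (Finset.range_mono hk.le)

lemma Dom_perm {N : ℕ} {lam : JPartition} {a : Fin N →₀ ℕ} (s : Equiv.Perm (Fin N))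
    (h : Dom lam a) : Dom lam (a.mapDomain s) := by
  refine ⟨?_, fun I => ?_⟩
  · rw [← h.1]
    refine Fintype.sum_equiv s.symm _ _ fun i => ?_
    rw [Finsupp.mapDomain_equiv_apply]
  · have := h.2 (I.map s.symm.toEmbedding)
    rw [Finset.sum_map, Finset.card_map] at this
    refine le_trans (le_of_eq ?_) this
    refine Finset.sum_congr rfl fun i _ => ?_
    rw [Finsupp.mapDomain_equiv_apply]
    rfl

lemma Dom_move {N : ℕ} {lam : JPartition} {b : Fin N →₀ ℕ} {i j : Fin N} (hb : b i = b j) {d s r : ℕ} (hd : s + r = d) (h : Dom lam (b + Finsupp.single i d)) :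
    Dom lam (b + Finsupp.single i s + Finsupp.single j r) := by
  have e : ∀ (I : Finset (Fin N)) (x : Fin N) (t : ℕ), ∑ y ∈ I, (Finsupp.single x t) y
      = if x ∈ I then t else 0 := by
    intro I x t
    simp [Finsupp.single_apply]
  have hbs : ∀ x, b (Equiv.swap i j x) = b x := by
    intro x
    rw [Equiv.swap_apply_def]
    split_ifs with h1 h2
    · rw [h1, hb]
    · rw [h2, hb]
    · rfl
  have H1 := h.1
  have H2 := h.2
  simp only [Finsupp.add_apply, Finset.sum_add_distrib, e] at H1 H2
  refine ⟨?_, fun I => ?_⟩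
  · simp only [Finsupp.add_apply, Finset.sum_add_distrib, e]
    simp only [Finset.mem_univ, if_true] at H1 ⊢
    omega
  · simp only [Finsupp.add_apply, Finset.sum_add_distrib, e]
    have h3 := H2 I
    have h4 := H2 (I.map (Equiv.swap i j).toEmbedding)
    rw [Finset.sum_map, Finset.card_map] at h4
    have h5 : (i ∈ I.map (Equiv.swap i j).toEmbedding) ↔ j ∈ I := by
      rw [Finset.mem_map_equiv, Equiv.symm_swap, Equiv.swap_apply_left]
    simp only [h5, Equiv.coe_toEmbedding, hbs] at h4
    split_ifs at h3 h4 ⊢ <;> omega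

end JA

namespace JA

open MvPolynomial

/-! ### Evaluation in finitely many variables -/

lemma evalN_X (N : ℕ) (k : ℕ+) : evalN N (X k) = ∑ j : Fin N, X j ^ (k : ℕ) := by
  rw [evalN, aeval_X]

lemma evalN_pp (N : ℕ) (t : ℕ) (ht : 0 < t) : evalN N (pp t) = ∑ j : Fin N, X j ^ t := by
  have := evalN_X N (Nat.toPNat t ht)
  rwa [← pp_pnat] at this

lemma evalN_symm (N : ℕ) (s : Equiv.Perm (Fin N)) (f : SymA) :
    rename s (evalN N f) = evalN N f := by
  have : (rename s).comp (evalN N) = evalN N := by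
    refine algHom_ext fun k => ?_
    rw [AlgHom.comp_apply, evalN_X, map_sum]
    simp only [map_pow, rename_X]
    exact Fintype.sum_equiv s _ _ fun _ => rfl
  exact AlgHom.congr_fun this f

lemma coeff_evalN_perm (N : ℕ) (s : Equiv.Perm (Fin N)) (f : SymA) (a : Fin N →₀ ℕ) :
    coeff (a.mapDomain s) (evalN N f) = coeff a (evalN N f) := by
  conv_lhs => rw [← evalN_symm N s f]
  exact coeff_rename_mapDomain _ s.injective _ _

lemma evalN_kill {N N' : ℕ} (h : N ≤ N') (f : SymA) :
    killCompl (Fin.castLE_injective h) (evalN N' f) = evalN N f := by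
  have : (killCompl (Fin.castLE_injective h)).comp (evalN N') = evalN N := by
    refine algHom_ext fun k => ?_
    rw [AlgHom.comp_apply, evalN_X, evalN_X, map_sum]
    symm
    have h1 : ∀ j : Fin N, (X j ^ (k : ℕ) : MvPolynomial (Fin N) F)
        = killCompl (Fin.castLE_injective h) (X (Fin.castLE h j) ^ (k : ℕ)) := by
      intro j
      rw [map_pow, ← rename_X (R := F) (Fin.castLE h) j, killCompl_rename_app]
    rw [Finset.sum_congr rfl fun j _ => h1 j]
    refine (Finset.sum_map Finset.univ (Fin.castLEEmb h)
      (fun j => killCompl (Fin.castLE_injective h)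
        (X j ^ (k : ℕ) : MvPolynomial (Fin N') F))).symm.trans ?_
    refine Finset.sum_subset (Finset.subset_univ _) fun j _ hj => ?_
    have hj' : j ∉ Set.range (Fin.castLE h) := by
      rintro ⟨i, rfl⟩
      exact hj (Finset.mem_map.2 ⟨i, Finset.mem_univ _, rfl⟩)
    rw [map_pow, killCompl, aeval_X, dif_neg hj', zero_pow k.ne_zero]
  exact AlgHom.congr_fun this f

lemma xexp_castLE {N N' : ℕ} (h : N ≤ N') (mu : JPartition) (hmu : plen mu ≤ N) :
    (xexp mu N).mapDomain (Fin.castLE h) = xexp mu N' := by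
  ext j
  by_cases hj : (j : ℕ) < N
  · have : j = Fin.castLE h ⟨j, hj⟩ := rfl
    rw [this, Finsupp.mapDomain_apply (Fin.castLE_injective h), xexp_apply, xexp_apply]
    rfl
  · rw [Finsupp.mapDomain_of_notMem_range, xexp_apply, part_eq_zero]
    · omega
    · rintro ⟨i, rfl⟩
      exact hj i.2

/-- coefficient of the monomial symmetric function `m_mu` -/
def mc (mu : JPartition) : SymA →ₗ[F] F :=
  (lcoeff F (xexp mu (plen mu))) ∘ₗ (evalN (plen mu)).toLinearMap

lemma mc_eq (mu : JPartition) (f : SymA) {N : ℕ} (h : plen mu ≤ N) :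
    coeff (xexp mu N) (evalN N f) = mc mu f := by
  show _ = coeff (xexp mu (plen mu)) (evalN (plen mu) f)
  rw [← evalN_kill h f, coeff_killCompl, xexp_castLE h mu le_rfl]

/-! ### injectivity -/

def phi {N : ℕ} (i : Fin N) : VY →ₐ[F] MvPolynomial (Fin N) F :=
  ((Polynomial.aeval (X i : MvPolynomial (Fin N) F)).restrictScalars F).comp
    (Polynomial.mapAlgHom (evalN N))

lemma phi_apply {N : ℕ} (i : Fin N) (G : VY) :
    phi i G = (G.map (evalN N).toRingHom).eval (X i) := by
  simp [phi, Polynomial.aeval_def, Polynomial.eval₂_eq_eval_map]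

lemma phi_monomial {N : ℕ} (i : Fin N) (m : ℕ) (f : SymA) :
    phi i (Polynomial.monomial m f) = evalN N f * X i ^ m := by
  rw [phi_apply, Polynomial.map_monomial, Polynomial.eval_monomial]; rfl

lemma phi_C {N : ℕ} (i : Fin N) (f : SymA) : phi i (Polynomial.C f) = evalN N f := by
  rw [← Polynomial.monomial_zero_left, phi_monomial, pow_zero, mul_one]

lemma phi_X {N : ℕ} (i : Fin N) : phi i (Polynomial.X : VY) = X i := by
  rw [phi_apply, Polynomial.map_X, Polynomial.eval_X]

lemma phi_nabla {N : ℕ} (i : Fin N) (f : SymA) :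
    phi i (nabla f) = alpha • (X i * pderiv i (evalN N f)) := by
  induction f using MvPolynomial.induction_on with
  | C a =>
    have : evalN N (C a) = C a := by rw [evalN, aeval_C]; rfl
    rw [this, pderiv_C, ← MvPolynomial.algebraMap_eq, Derivation.map_algebraMap]
    simp
  | add p q hp hq => rw [map_add, map_add, map_add, map_add, hp, hq, mul_add, smul_add]
  | mul_X p k hp =>
    rw [Derivation.leibniz, map_add, Polynomial.smul_eq_C_mul, Polynomial.smul_eq_C_mul, map_mul,
      map_mul, hp, nabla_X, map_smul, map_pow, phi_X, phi_C, phi_C, map_mul, Derivation.leibniz,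
      evalN_X]
    have h1 : X i * pderiv i (∑ j : Fin N, (X j : MvPolynomial (Fin N) F) ^ (k : ℕ))
        = ((k : ℕ) : F) • X i ^ (k : ℕ) := by
      rw [map_sum, Finset.sum_eq_single i]
      · rw [Derivation.leibniz_pow, pderiv_X_self, smul_eq_mul, mul_one, mul_smul_comm,
          mul_pow_sub_one k.ne_zero, Nat.cast_smul_eq_nsmul]
      · intro j _ hj
        rw [Derivation.leibniz_pow, pderiv_X_of_ne hj]; simp
      · simp
    rw [smul_eq_mul, smul_eq_mul, mul_add, mul_left_comm, h1, mul_smul, smul_add]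
    simp only [mul_smul_comm]
    congr 2
    ring

lemma evalN_inj_aux (n : ℕ) : ∀ f ∈ Fil ((n : ℤ) - 1), (∀ N, evalN N f = 0) → f = 0 := by
  induction n with
  | zero =>
    intro f hf _
    ext m
    by_contra h
    have := hf m h
    omega
  | succ n ih =>
    intro f hf h
    have hd : ∀ k, dd k f = 0 := by
      intro k
      rcases Nat.eq_zero_or_pos k with rfl | hk
      · rw [dd_zero]; rfl
      refine ih _ (Fil_mono (by push_cast; omega) (dd_mem k hf)) fun N => ?_
      set N' := N + (nabla f).natDegree + 1 with hN'
      have h1 : (nabla f).map (evalN N').toRingHom = 0 := by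
        refine Polynomial.eq_zero_of_natDegree_lt_card_of_eval_eq_zero _
          (f := fun i : Fin N' => X i) (X_injective) (fun i => ?_) ?_
        · rw [← phi_apply, phi_nabla, h]; simp
        · rw [Fintype.card_fin]
          have := Polynomial.natDegree_map_le (f := (evalN N').toRingHom) (p := nabla f)
          omega
      have h2 := congrArg (fun P => Polynomial.coeff P k) h1
      simp only [Polynomial.coeff_map, coeff_nabla, Polynomial.coeff_zero] at h2
      have h3 : evalN N' (dd k f) = 0 := h2
      rw [← evalN_kill (show N ≤ N' by omega), h3, map_zero]
    have hc : ∀ m : Exp, m ≠ 0 → coeff m f = 0 := by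
      intro m hm
      obtain ⟨k, hk⟩ : ∃ k, m k ≠ 0 := by
        by_contra hcon
        push Not at hcon
        exact hm (Finsupp.ext hcon)
      have hmk : m = (m - Finsupp.single k 1) + Finsupp.single k 1 := by
        rw [tsub_add_cancel_of_le]
        rw [Finsupp.single_le_iff]
        omega
      have hfm : (monomial m (1 : F) : SymA) = pp k * monomial (m - Finsupp.single k 1) 1 := by
        conv_lhs => rw [hmk]
        rw [pp_pnat, X, monomial_mul, one_mul, add_comm]
      have e := hall_adj1 k (monomial (m - Finsupp.single k 1) 1) f
      rw [← hfm, hd, map_zero, hallL_monomial_left, one_mul] at e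
      exact (mul_eq_zero.1 e).resolve_right (zalpha_ne_zero m)
    have hf0 : f = C (coeff 0 f) := by
      ext m
      rw [coeff_C]
      split_ifs with h0
      · rw [h0]
      · exact hc m (Ne.symm h0)
    have := h 0
    rw [hf0, evalN, aeval_C] at this
    have h0 : coeff 0 f = 0 := by
      have h5 : (C (coeff 0 f) : MvPolynomial (Fin 0) F) = 0 := this
      rwa [map_eq_zero_iff _ (C_injective _ _)] at h5
    rw [hf0, h0, map_zero]

lemma exists_Fil (f : SymA) : ∃ n : ℕ, f ∈ Fil (n : ℤ) := by
  refine ⟨f.support.sup wt, fun m hm => ?_⟩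
  exact_mod_cast Finset.le_sup (f := wt) (mem_support_iff.2 hm)

lemma evalN_inj {f : SymA} (h : ∀ N, evalN N f = 0) : f = 0 := by
  obtain ⟨n, hn⟩ := exists_Fil f
  exact evalN_inj_aux (n + 1) f (Fil_mono (by push_cast; omega) hn) h

lemma mc_inj {f : SymA} (h : ∀ mu, mc mu f = 0) : f = 0 := by
  refine evalN_inj fun N => ?_
  ext a
  obtain ⟨mu, hmu, s, rfl⟩ := exists_perm_xexp a
  rw [coeff_evalN_perm, mc_eq mu f hmu, h, coeff_zero]

/-! ### the operators preserve the dominance filtration -/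

/-- polynomials with support in the dominance ideal -/
def WW (N : ℕ) (lam : JPartition) : Submodule F (MvPolynomial (Fin N) F) where
  carrier := {P | ∀ a, coeff a P ≠ 0 → Dom lam a}
  zero_mem' := by intro m; simp
  add_mem' := by
    intro f g hf hg m h
    by_cases h1 : coeff m f = 0
    · refine hg m fun h2 => h ?_
      rw [coeff_add, h1, h2, add_zero]
    · exact hf m h1
  smul_mem' := by
    intro c f hf m h
    refine hf m fun h2 => h ?_
    rw [coeff_smul, h2, smul_zero]

lemma monomial_mem_WW {N : ℕ} {lam : JPartition} {a : Fin N →₀ ℕ} {c : F} (h : Dom lam a) :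
    monomial a c ∈ WW N lam := by
  intro n hn
  rw [coeff_monomial] at hn
  split_ifs at hn with h1
  · rwa [← h1]
  · exact absurd rfl hn

lemma geom_aux {R : Type*} [CommRing R] (x y : R) (d : ℕ) :
    (x - y) * ∑ t ∈ Finset.range d, x ^ (d - 1 - t) * y ^ (t + 1) = y * (x ^ d - y ^ d) := by
  have h := Commute.geom_sum₂_mul (Commute.all y x) d
  have h2 : ∑ t ∈ Finset.range d, x ^ (d - 1 - t) * y ^ (t + 1)
      = y * ∑ t ∈ Finset.range d, y ^ t * x ^ (d - 1 - t) := by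
    rw [Finset.mul_sum]
    refine Finset.sum_congr rfl fun t _ => ?_
    ring
  rw [h2]
  linear_combination (-y) * h

lemma smooth_mono {N : ℕ} {lam : JPartition} {i j : Fin N} {a : Fin N →₀ ℕ} (h : Dom lam a)
    (hle : a j ≤ a i) (hij : i ≠ j) : ∃ Q ∈ WW N lam, (X i - X j) * Q =
      X j * (monomial a (1 : F) - rename (Equiv.swap i j) (monomial a (1 : F))) := by
  set d := a i - a j with hd
  set b := a - Finsupp.single i d with hb
  have hab : a = b + Finsupp.single i d := by
    rw [hb, tsub_add_cancel_of_le]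
    rw [Finsupp.single_le_iff]
    omega
  have hbij : b i = b j := by
    rw [hb, Finsupp.tsub_apply, Finsupp.tsub_apply, Finsupp.single_eq_same,
      Finsupp.single_eq_of_ne hij.symm]
    omega
  have hbs : b.mapDomain (Equiv.swap i j) = b := by
    ext x
    rw [Finsupp.mapDomain_equiv_apply, Equiv.symm_swap, Equiv.swap_apply_def]
    split_ifs with h1 h2
    · rw [h1, hbij]
    · rw [h2, hbij]
    · rfl
  have hm : (monomial a (1 : F)) = monomial b 1 * X i ^ d := by
    rw [X_pow_eq_monomial, monomial_mul, one_mul, ← hab]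
  refine ⟨monomial b 1 * ∑ t ∈ Finset.range d, X i ^ (d - 1 - t) * X j ^ (t + 1), ?_, ?_⟩
  · rw [Finset.mul_sum]
    refine Submodule.sum_mem _ fun t ht => ?_
    rw [X_pow_eq_monomial, X_pow_eq_monomial, monomial_mul, monomial_mul, ← add_assoc]
    refine monomial_mem_WW (Dom_move hbij (d := d) ?_ (hab ▸ h))
    have := Finset.mem_range.1 ht
    omega
  · rw [mul_left_comm, geom_aux, hm, map_mul, rename_monomial, hbs, map_pow, rename_X,
      Equiv.swap_apply_left]
    ring

lemma smooth {N : ℕ} {lam : JPartition} {i j : Fin N} (hij : i ≠ j)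
    {P : MvPolynomial (Fin N) F} (hP : P ∈ WW N lam) : ∃ Q ∈ WW N lam, (X i - X j) * Q =
      X j * (P - rename (Equiv.swap i j) P) := by
  have key : ∀ a, Dom lam a → ∃ Q ∈ WW N lam, (X i - X j) * Q =
      X j * (monomial a (1 : F) - rename (Equiv.swap i j) (monomial a (1 : F))) := by
    intro a ha
    rcases le_total (a j) (a i) with h | h
    · exact smooth_mono ha h hij
    · obtain ⟨Q, h1, h2⟩ := smooth_mono (i := i) (j := j)
        (Dom_perm (Equiv.swap i j) ha) (by
          rw [Finsupp.mapDomain_equiv_apply, Finsupp.mapDomain_equiv_apply, Equiv.symm_swap,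
            Equiv.swap_apply_left, Equiv.swap_apply_right]
          exact h) hij
      refine ⟨-Q, neg_mem h1, ?_⟩
      rw [mul_neg, h2, ← rename_monomial, rename_rename]
      have : (Equiv.swap i j : Fin N → Fin N) ∘ (Equiv.swap i j) = id := by
        ext x; simp
      rw [this, rename_id_apply]
      ring
  choose! Q hQ1 hQ2 using key
  refine ⟨∑ a ∈ P.support, coeff a P • Q a, ?_, ?_⟩
  · refine Submodule.sum_mem _ fun a ha => Submodule.smul_mem _ _ ?_
    exact hQ1 a (hP a (mem_support_iff.1 ha))
  · have hPs : P = ∑ a ∈ P.support, coeff a P • monomial a (1 : F) := by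
      conv_lhs => rw [P.as_sum]
      refine Finset.sum_congr rfl fun a _ => ?_
      rw [smul_monomial, smul_eq_mul, mul_one]
    have hr : rename (Equiv.swap i j) P =
        ∑ a ∈ P.support, coeff a P • rename (Equiv.swap i j) (monomial a (1 : F)) := by
      conv_lhs => rw [hPs]
      rw [map_sum]
      exact Finset.sum_congr rfl fun a _ => map_smul _ _ _
    have hsub : P - rename (Equiv.swap i j) P = ∑ a ∈ P.support, coeff a P •
        (monomial a (1 : F) - rename (Equiv.swap i j) (monomial a (1 : F))) := by
      rw [hr]
      simp only [smul_sub]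
      rw [Finset.sum_sub_distrib, ← hPs]
    rw [hsub, Finset.mul_sum, Finset.mul_sum]
    refine Finset.sum_congr rfl fun a ha => ?_
    rw [mul_smul_comm, hQ2 a (hP a (mem_support_iff.1 ha)), mul_smul_comm]

/-- divided difference part -/
def RR {N : ℕ} (i j : Fin N) : VY →ₗ[F] MvPolynomial (Fin N) F :=
  Polynomial.lsum fun m => LinearMap.mulRight F
    (∑ t ∈ Finset.range m, X i ^ (m - 1 - t) * X j ^ (t + 1)) ∘ₗ (evalN N).toLinearMap

lemma RR_monomial {N : ℕ} (i j : Fin N) (m : ℕ) (f : SymA) : RR i j (Polynomial.monomial m f)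
    = evalN N f * ∑ t ∈ Finset.range m, X i ^ (m - 1 - t) * X j ^ (t + 1) := by
  rw [RR, Polynomial.lsum_apply, Polynomial.sum_monomial_index _ _ (by simp)]
  rfl

lemma RR_spec {N : ℕ} (i j : Fin N) (G : VY) :
    (X i - X j) * RR i j G = X j * (phi i G - rename (Equiv.swap i j) (phi i G)) := by
  have : LinearMap.mulLeft F (X i - X j : MvPolynomial (Fin N) F) ∘ₗ RR i j
    = LinearMap.mulLeft F (X j : MvPolynomial (Fin N) F) ∘ₗ ((phi i).toLinearMap -
      (rename (Equiv.swap i j)).toLinearMap ∘ₗ (phi i).toLinearMap) := by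
    refine vy_ext fun m f => ?_
    simp only [LinearMap.comp_apply, LinearMap.mulLeft_apply, LinearMap.sub_apply,
      AlgHom.toLinearMap_apply, phi_monomial, RR_monomial]
    rw [mul_left_comm, geom_aux, map_mul, evalN_symm, map_pow, rename_X, Equiv.swap_apply_left]
    ring
  exact LinearMap.congr_fun this G

lemma RR_mem {N : ℕ} {lam : JPartition} {i j : Fin N} (hij : i ≠ j) {G : VY}
    (hG : phi i G ∈ WW N lam) : RR i j G ∈ WW N lam := by
  obtain ⟨Q, h1, h2⟩ := smooth hij hG
  have h3 : (X i - X j : MvPolynomial (Fin N) F) ≠ 0 := by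
    rw [sub_ne_zero]
    exact fun h => hij (X_injective h)
  have : RR i j G = Q := mul_left_cancel₀ h3 (by rw [RR_spec, h2])
  rwa [this]

lemma phi_LL {N : ℕ} (i : Fin N) (G : VY) : phi i (LL 0 G) =
    alpha • (X i * pderiv i (phi i G)) + ∑ j ∈ Finset.univ.erase i, RR i j G := by
  have : (phi i).toLinearMap ∘ₗ LL 0 = alpha • (LinearMap.mulLeft F (X i) ∘ₗ
      (pderiv i).toLinearMap ∘ₗ (phi i).toLinearMap) + ∑ j ∈ Finset.univ.erase i, RR i j := by
    refine vy_ext fun m f => ?_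
    simp only [LinearMap.comp_apply, LinearMap.add_apply, LinearMap.smul_apply,
      LinearMap.mulLeft_apply, LinearMap.sum_apply, AlgHom.toLinearMap_apply, phi_monomial,
      RR_monomial, LL_monomial, Lmon_apply, zero_smul, add_zero]
    have h1 : ∑ t ∈ Finset.range m, phi i (Polynomial.monomial (m - 1 - t) (pp (t + 1) * f))
      = (m : F) • (evalN N f * X i ^ m) + ∑ j ∈ Finset.univ.erase i,
        evalN N f * ∑ t ∈ Finset.range m, X i ^ (m - 1 - t) * X j ^ (t + 1) := by
      have h2 : ∀ t ∈ Finset.range m,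
          phi i (Polynomial.monomial (m - 1 - t) (pp (t + 1) * f)) =
          ∑ j, evalN N f * (X i ^ (m - 1 - t) * X j ^ (t + 1)) := by
        intro t _
        rw [phi_monomial, map_mul, evalN_pp N _ (by omega), ← Finset.mul_sum, ← Finset.mul_sum]
        ring
      rw [Finset.sum_congr rfl h2, Finset.sum_comm, ← Finset.add_sum_erase _ _ (Finset.mem_univ i)]
      congr 1
      · have h3 : ∀ t ∈ Finset.range m, evalN N f * (X i ^ (m - 1 - t) * X i ^ (t + 1))
          = evalN N f * X i ^ m := by
          intro t ht
          have := Finset.mem_range.1 ht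
          rw [← pow_add]
          congr 2
          omega
        rw [Finset.sum_congr rfl h3, Finset.sum_const, Finset.card_range, Nat.cast_smul_eq_nsmul]
      · exact Finset.sum_congr rfl fun j _ => (Finset.mul_sum _ _ _).symm
    rw [map_add, map_add, map_mul, phi_nabla, map_pow, phi_X, map_smul, phi_monomial, map_sum, h1,
      ← add_assoc]
    congr 1
    show _ = alpha • (X i * pderiv i (evalN N f * X i ^ m))
    rw [Derivation.leibniz, smul_eq_mul, smul_eq_mul, Derivation.leibniz_pow, pderiv_X_self]
    have h4 : (X i : MvPolynomial (Fin N) F) * (evalN N f * (m • (X i : MvPolynomial (Fin N) F) ^ (m - 1) • (1 : MvPolynomial (Fin N) F)))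
        = (m : F) • (evalN N f * X i ^ m) := by
      rcases Nat.eq_zero_or_pos m with rfl | hm
      · simp
      · rw [smul_eq_mul, mul_one, mul_smul_comm, mul_smul_comm, mul_left_comm,
          mul_pow_sub_one hm.ne', Nat.cast_smul_eq_nsmul]
    rw [mul_add, h4, smul_add, smul_smul, add_assoc, ← add_smul, smul_mul_assoc, add_comm]
    congr 1
    · congr 1; ring
    · congr 1; ring
  have h := LinearMap.congr_fun this G
  simpa using h

lemma euler_mem {N : ℕ} {lam : JPartition} (i : Fin N) {P : MvPolynomial (Fin N) F}
    (hP : P ∈ WW N lam) : X i * pderiv i P ∈ WW N lam := by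
  rw [P.as_sum, map_sum, Finset.mul_sum]
  refine Submodule.sum_mem _ fun a ha => ?_
  rw [X_mul_pderiv_monomial]
  exact Submodule.smul_of_tower_mem _ _ (monomial_mem_WW (hP a (mem_support_iff.1 ha)))

lemma phi_LL_mem {N : ℕ} {lam : JPartition} (i : Fin N) {G : VY} (hG : phi i G ∈ WW N lam) :
    phi i (LL 0 G) ∈ WW N lam := by
  rw [phi_LL]
  refine add_mem (Submodule.smul_mem _ _ (euler_mem i hG)) (Submodule.sum_mem _ fun j hj => ?_)
  exact RR_mem (Finset.ne_of_mem_erase hj).symm hG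

lemma sum_phi {N : ℕ} (G : VY) : ∑ i, phi i G = evalN N (ppi G) + (N : F) • evalN N (c0 G) := by
  have : ∑ i : Fin N, (phi i).toLinearMap = (evalN N).toLinearMap ∘ₗ (ppi.restrictScalars F) +
      (N : F) • ((evalN N).toLinearMap ∘ₗ c0) := by
    refine vy_ext fun m f => ?_
    simp only [LinearMap.comp_apply, LinearMap.add_apply, LinearMap.smul_apply,
      LinearMap.sum_apply, AlgHom.toLinearMap_apply, phi_monomial, ppi_monomial, c0_apply,
      LinearMap.restrictScalars_apply, Polynomial.coeff_monomial]
    rcases Nat.eq_zero_or_pos m with rfl | hm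
    · simp [pp_zero, Nat.cast_smul_eq_nsmul]
    · rw [if_neg hm.ne', map_zero, smul_zero, add_zero, map_mul, evalN_pp N m hm, Finset.mul_sum]
  have h := LinearMap.congr_fun this G
  simpa using h

/-- symmetric functions below `lam` -/
def VV (lam : JPartition) : Submodule F SymA where
  carrier := {f | ∀ N, evalN N f ∈ WW N lam}
  zero_mem' := by intro N; rw [map_zero]; exact zero_mem _
  add_mem' := by intro f g hf hg N; rw [map_add]; exact add_mem (hf N) (hg N)
  smul_mem' := by intro c f hf N; rw [map_smul]; exact Submodule.smul_mem _ _ (hf N)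

lemma UU_mem_VV {lam : JPartition} {f : SymA} (hf : f ∈ VV lam) (k : ℕ) : UU 0 k f ∈ VV lam := by
  have h1 : ∀ k N (i : Fin N), phi i (((LL 0) ^ k) (Polynomial.C f)) ∈ WW N lam := by
    intro k N i
    induction k with
    | zero => rw [pow_zero, Module.End.one_apply, phi_C]; exact hf N
    | succ k ih => rw [pow_succ', Module.End.mul_apply]; exact phi_LL_mem i ih
  have hU : ∀ k, UU 0 k f = c0 (((LL 0) ^ k) (Polynomial.C f)) := fun k => rfl
  induction k with
  | zero =>
    have : UU 0 0 f = f := by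
      rw [hU, pow_zero, Module.End.one_apply, c0_apply, Polynomial.coeff_C_zero]
    rwa [this]
  | succ k ih =>
    intro N
    have h2 := sum_phi (N := N) (((LL 0) ^ k) (Polynomial.C f))
    rw [← c0_LL 0, ← Module.End.mul_apply, ← pow_succ', ← hU, ← hU, ← sub_eq_iff_eq_add] at h2
    rw [← h2]
    exact sub_mem (Submodule.sum_mem _ fun i _ => h1 k N i) (Submodule.smul_mem _ _ (ih N))

end JA

namespace JA

open MvPolynomial

/-! ### partitions versus exponent vectors -/

lemma toExp_apply (l : JPartition) (i : ℕ+) : toExp l i = Multiset.count i l := by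
  rw [toExp, Finsupp.finsetSum_apply]
  by_cases h : i ∈ l
  · rw [Finset.sum_eq_single i]
    · simp
    · intro j _ hj
      simp [Finsupp.single_apply, hj]
    · intro hi
      exact absurd (Multiset.mem_toFinset.2 h) hi
  · rw [Multiset.count_eq_zero_of_notMem h]
    refine Finset.sum_eq_zero fun j hj => ?_
    have : j ≠ i := by
      rintro rfl
      exact h (Multiset.mem_toFinset.1 hj)
    simp [Finsupp.single_apply, this]

lemma toExp_zero : toExp 0 = 0 := by
  ext i; simp [toExp_apply]

lemma toExp_add (l l' : JPartition) : toExp (l + l') = toExp l + toExp l' := by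
  ext i; simp [toExp_apply]

lemma toExp_replicate (n : ℕ) (i : ℕ+) :
    toExp (Multiset.replicate n i) = Finsupp.single i n := by
  ext j
  rw [toExp_apply, Multiset.count_replicate, Finsupp.single_apply]

lemma toExp_cons (i : ℕ+) (l : JPartition) : toExp (i ::ₘ l) = Finsupp.single i 1 + toExp l := by
  rw [← Multiset.singleton_add, toExp_add, ← Multiset.replicate_one, toExp_replicate]

lemma toExp_injective : Function.Injective toExp := by
  intro l l' h
  ext i
  rw [← toExp_apply, h, toExp_apply]

lemma toExp_toPart (m : Exp) : toExp (toPart m) = m := by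
  ext i
  rw [toExp_apply, toPart, Finsupp.sum, Multiset.count_sum']
  by_cases h : i ∈ m.support
  · rw [Finset.sum_eq_single i]
    · simp
    · intro j _ hj
      rw [Multiset.count_replicate, if_neg hj]
    · intro hi
      exact absurd h hi
  · rw [Finsupp.notMem_support_iff.1 h]
    refine Finset.sum_eq_zero fun j hj => ?_
    rw [Multiset.count_replicate, if_neg]
    rintro rfl
    exact h hj

lemma toPart_toExp (l : JPartition) : toPart (toExp l) = l :=
  toExp_injective (toExp_toPart _)

lemma wt_zero : wt 0 = 0 := by simp [wt]

lemma wt_toExp (l : JPartition) : wt (toExp l) = psize l := by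
  rw [psize_eq]
  induction l using Multiset.induction_on with
  | empty => simp [toExp_zero, wt_zero]
  | cons i l ih => rw [toExp_cons, wt_add, wt_single, ih]; simp

lemma psize_toPart (m : Exp) : psize (toPart m) = wt m := by
  rw [← wt_toExp, toExp_toPart]

/-! ### homogeneity -/

lemma evalN_homog (N : ℕ) (m : Exp) : (evalN N (monomial m 1)).IsHomogeneous (wt m) := by
  rw [evalN, aeval_monomial, map_one, one_mul]
  unfold wt Finsupp.sum Finsupp.prod
  refine IsHomogeneous.prod _ _ _ fun i _ => ?_
  beta_reduce
  rw [mul_comm]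
  refine IsHomogeneous.pow (IsHomogeneous.sum _ _ _ fun j _ => ?_) _
  simpa using (isHomogeneous_X F j).pow (i : ℕ)

lemma coeff_evalN_ne {N : ℕ} {f : SymA} {a : Fin N →₀ ℕ} (h : coeff a (evalN N f) ≠ 0) :
    ∃ m, coeff m f ≠ 0 ∧ ∑ i, a i = wt m := by
  have hf : evalN N f = ∑ m ∈ f.support, coeff m f • evalN N (monomial m 1) := by
    conv_lhs => rw [f.as_sum]
    rw [map_sum]
    refine Finset.sum_congr rfl fun m _ => ?_
    rw [← map_smul, smul_monomial, smul_eq_mul, mul_one]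
  rw [hf, coeff_sum] at h
  obtain ⟨m, hm, hne⟩ := Finset.exists_ne_zero_of_sum_ne_zero h
  refine ⟨m, mem_support_iff.1 hm, ?_⟩
  rw [coeff_smul] at hne
  have h2 : coeff a (evalN N (monomial m 1)) ≠ 0 := fun h0 => hne (by rw [h0, smul_zero])
  have := evalN_homog N m h2
  rw [← this, Finsupp.weight_apply, Finsupp.sum_fintype _ _ (by simp)]
  simp

lemma mc_ne {mu : JPartition} {f : SymA} (h : mc mu f ≠ 0) :
    ∃ m, coeff m f ≠ 0 ∧ psize mu = wt m := by
  rw [← mc_eq mu f le_rfl] at h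
  obtain ⟨m, h1, h2⟩ := coeff_evalN_ne h
  exact ⟨m, h1, by rw [← h2, sum_xexp mu _ le_rfl]⟩

lemma homog_of_mc {f : SymA} {n : ℕ} (h : ∀ mu, mc mu f ≠ 0 → psize mu = n) (m : Exp)
    (hm : coeff m f ≠ 0) : wt m = n := by
  set f2 : SymA := ∑ m ∈ f.support with wt m ≠ n, monomial m (coeff m f) with hf2
  set f1 : SymA := ∑ m ∈ f.support with wt m = n, monomial m (coeff m f) with hf1
  have hs : f = f1 + f2 := by
    conv_lhs => rw [f.as_sum]
    exact (Finset.sum_filter_add_sum_filter_not _ _ _).symm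
  have c2 : ∀ m, coeff m f2 = if wt m ≠ n then coeff m f else 0 := by
    intro m
    rw [hf2, coeff_sum]
    simp only [coeff_monomial, Finset.sum_ite_eq', Finset.mem_filter, mem_support_iff]
    by_cases h1 : coeff m f = 0 <;> simp [h1]
  have c1 : ∀ m, coeff m f1 = if wt m = n then coeff m f else 0 := by
    intro m
    rw [hf1, coeff_sum]
    simp only [coeff_monomial, Finset.sum_ite_eq', Finset.mem_filter, mem_support_iff]
    by_cases h1 : coeff m f = 0 <;> simp [h1]
  have h0 : f2 = 0 := by
    refine mc_inj fun mu => ?_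
    by_contra hne
    obtain ⟨q, hq1, hq2⟩ := mc_ne hne
    rw [c2] at hq1
    have hq3 : wt q ≠ n := fun h => hq1 (by simp [h])
    have h3 : mc mu f1 = 0 := by
      by_contra hne1
      obtain ⟨q', hq1', hq2'⟩ := mc_ne hne1
      rw [c1] at hq1'
      have hq3' : wt q' = n := by
        by_contra h; exact hq1' (by simp [h])
      omega
    have h4 : mc mu f ≠ 0 := by rwa [hs, map_add, h3, zero_add]
    exact hq3 (by rw [← hq2, h mu h4])
  by_contra hw
  have := c2 m
  rw [h0, coeff_zero, if_pos hw] at this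
  exact hm this.symm

/-! ### Jack polynomials -/

section jack
variable {J : JPartition → SymA} (hJ : IsJackFamily J)
include hJ

lemma mc_J {nu lam : JPartition} (h : mc nu (J lam) ≠ 0) : dominates nu lam := by
  by_contra hd
  have := hJ.triangular lam nu hd
  rw [mc_eq nu _ (by omega)] at this
  exact h this

lemma J_mem_VV (lam : JPartition) : J lam ∈ VV lam := by
  intro N a ha
  obtain ⟨mu, hmu, s, rfl⟩ := exists_perm_xexp a
  rw [coeff_evalN_perm, mc_eq mu _ hmu] at ha
  exact Dom_perm s (Dom_xexp hmu (mc_J hJ ha))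

omit hJ in
lemma mc_VV {nu lam : JPartition} {f : SymA} (hf : f ∈ VV lam) (h : mc nu f ≠ 0) :
    dominates nu lam := by
  rw [← mc_eq nu f le_rfl] at h
  exact dominates_of_Dom (hf _ _ h)

lemma J_homog {lam : JPartition} {m : Exp} (h : coeff m (J lam) ≠ 0) : wt m = psize lam :=
  homog_of_mc (fun mu hmu => (mc_J hJ hmu).1) m h

lemma J_ne (lam : JPartition) : J lam ≠ 0 := by
  intro h
  have := hJ.normalized lam
  rw [h, coeff_zero] at this
  exact zero_ne_one this

lemma hall_J_self (lam : JPartition) : hallL (J lam) (J lam) ≠ 0 := fun h => J_ne hJ lam (hall_self h)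

lemma hall_J_sum (S : Finset JPartition) (c : JPartition → F) (mu : JPartition) :
    hallL (∑ nu ∈ S, c nu • J nu) (J mu) = if mu ∈ S then c mu * hallL (J mu) (J mu) else 0 := by
  rw [map_sum, LinearMap.sum_apply]
  have : ∀ nu ∈ S, hallL (c nu • J nu) (J mu) =
      if nu = mu then c mu * hallL (J mu) (J mu) else 0 := by
    intro nu _
    rw [map_smul, LinearMap.smul_apply, smul_eq_mul]
    split_ifs with h
    · rw [h]
    · rw [hallL_apply, hJ.orthogonal nu mu h, mul_zero]
  rw [Finset.sum_congr rfl this, Finset.sum_ite_eq']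

lemma J_span (S : Finset JPartition) (hS : ∀ mu ∈ S, ∀ nu, mc nu (J mu) ≠ 0 → nu ∈ S) {f : SymA}
    (hf : ∀ nu, mc nu f ≠ 0 → nu ∈ S) : ∃ c : JPartition → F, f = ∑ mu ∈ S, c mu • J mu := by
  let A : (S → F) →ₗ[F] SymA := Fintype.linearCombination F (fun mu : S => J mu)
  let B : SymA →ₗ[F] (S → F) := LinearMap.pi fun mu : S => mc mu
  have hA : ∀ c, A c = ∑ mu : S, c mu • J mu := fun c => Fintype.linearCombination_apply _ _ _
  have hz : ∀ f : SymA, (∀ nu, mc nu f ≠ 0 → nu ∈ S) → B f = 0 → f = 0 := by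
    intro f hf hB
    refine mc_inj fun nu => ?_
    by_contra hne
    exact hne (congrFun hB ⟨nu, hf nu hne⟩)
  have hmA : ∀ c nu, mc nu (A c) ≠ 0 → nu ∈ S := by
    intro c nu h
    rw [hA, map_sum] at h
    obtain ⟨mu, _, h2⟩ := Finset.exists_ne_zero_of_sum_ne_zero h
    rw [map_smul] at h2
    exact hS mu mu.2 nu fun h0 => h2 (by rw [h0, smul_zero])
  have hinj : Function.Injective (B ∘ₗ A) := by
    rw [injective_iff_map_eq_zero]
    intro c hc
    have h0 : A c = 0 := hz _ (hmA c) hc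
    funext mu
    have h1 : A c = ∑ nu ∈ S, (if h : nu ∈ S then c ⟨nu, h⟩ else 0) • J nu := by
      rw [hA, ← Finset.sum_attach S, Finset.univ_eq_attach]
      refine Finset.sum_congr rfl fun x _ => ?_
      rw [dif_pos x.2]
    have h2 := hall_J_sum hJ S (fun nu => if h : nu ∈ S then c ⟨nu, h⟩ else 0) mu
    rw [← h1, h0, map_zero, LinearMap.zero_apply, if_pos mu.2, dif_pos mu.2] at h2
    exact (mul_eq_zero.1 h2.symm).resolve_right (hall_J_self hJ mu)
  have hsurj := LinearMap.injective_iff_surjective.1 hinj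
  obtain ⟨c, hc⟩ := hsurj (B f)
  refine ⟨fun nu => if h : nu ∈ S then c ⟨nu, h⟩ else 0, ?_⟩
  have h1 : f - A c = 0 := by
    refine hz _ (fun nu h => ?_) (by rw [map_sub, ← hc]; simp)
    rw [map_sub] at h
    by_contra hn
    have a1 : mc nu f = 0 := by_contra fun h' => hn (hf nu h')
    have a2 : mc nu (A c) = 0 := by_contra fun h' => hn (hmA c nu h')
    exact h (by rw [a1, a2, sub_zero])
  rw [sub_eq_zero.1 h1, hA, ← Finset.sum_attach S, Finset.univ_eq_attach]
  refine Finset.sum_congr rfl fun x _ => ?_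
  beta_reduce
  rw [dif_pos x.2]

lemma VV_span {lam : JPartition} {f : SymA} (hf : f ∈ VV lam) : ∃ (S : Finset JPartition)
    (c : JPartition → F), (∀ mu ∈ S, dominates mu lam) ∧ f = ∑ mu ∈ S, c mu • J mu := by
  have hfin : {mu : JPartition | dominates mu lam}.Finite :=
    (finite_psize_le (psize lam)).subset fun mu hmu => le_of_eq hmu.1
  obtain ⟨c, hc⟩ := J_span hJ hfin.toFinset (f := f) (fun mu hmu nu hnu => by
      rw [Set.Finite.mem_toFinset] at hmu ⊢
      have h1 := mc_J hJ hnu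
      exact ⟨h1.1.trans hmu.1, fun k => (h1.2 k).trans (hmu.2 k)⟩) (fun nu hnu => by
      rw [Set.Finite.mem_toFinset]
      exact mc_VV hf hnu)
  exact ⟨_, c, fun mu hmu => by simpa using hmu, hc⟩

lemma J_span_all (f : SymA) : ∃ (S : Finset JPartition) (c : JPartition → F),
    f = ∑ mu ∈ S, c mu • J mu := by
  obtain ⟨n, hn⟩ := exists_Fil f
  obtain ⟨c, hc⟩ := J_span hJ (finite_psize_le n).toFinset (f := f) (fun mu hmu nu hnu => by
      rw [Set.Finite.mem_toFinset] at hmu ⊢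
      have h1 := mc_J hJ hnu
      exact le_trans (le_of_eq h1.1) hmu) (fun nu hnu => by
      rw [Set.Finite.mem_toFinset]
      obtain ⟨m, h1, h2⟩ := mc_ne hnu
      have := hn m h1
      show psize nu ≤ n
      omega)
  exact ⟨_, c, hc⟩

lemma UU_J (k : ℕ) (lam : JPartition) : ∃ h : F, UU 0 k (J lam) = h • J lam := by
  obtain ⟨S, c, hS, hc⟩ := VV_span hJ (UU_mem_VV (J_mem_VV hJ lam) k)
  have hz : ∀ mu ∈ S, mu ≠ lam → c mu = 0 := by
    intro mu hmu hne
    have h1 := hall_J_sum hJ S c mu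
    rw [← hc, if_pos hmu, UU_adj hall_AdjB] at h1
    obtain ⟨S', c', hS', hc'⟩ := VV_span hJ (UU_mem_VV (J_mem_VV hJ mu) k)
    rw [hallL_symm, hc', hall_J_sum hJ, if_neg] at h1
    · exact (mul_eq_zero.1 h1.symm).resolve_right (hall_J_self hJ mu)
    · intro hl
      exact hne (dominates_antisymm (hS mu hmu) (hS' lam hl))
  by_cases hl : lam ∈ S
  · refine ⟨c lam, ?_⟩
    rw [hc]
    exact Finset.sum_eq_single lam (fun mu hmu hne => by rw [hz mu hmu hne, zero_smul])
      (fun h => absurd hl h)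
  · refine ⟨0, ?_⟩
    rw [hc, zero_smul]
    exact Finset.sum_eq_zero fun mu hmu => by
      rw [hz mu hmu (fun h => hl (h ▸ hmu)), zero_smul]

omit hJ in
/-- the linear map realizing the Jack characters -/
def Th (J : JPartition → SymA) : SymA →ₗ[F] (JPartition → F) := LinearMap.pi fun lam => hall1 (J lam)

omit hJ in
lemma Th_apply (f : SymA) (lam : JPartition) : Th J f lam = hallL (tau (J lam)) f := rfl

lemma Th_UU : ∃ hh : ℕ → JPartition → F, ∀ k f, Th J (UU 1 k f) = hh k * Th J f := by
  choose hh hhh using fun k lam => UU_J hJ k lam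
  refine ⟨hh, fun k f => ?_⟩
  funext lam
  show hall1 (J lam) (UU 1 k f) = hh k lam * hall1 (J lam) f
  rw [← UU_adj hall1_AdjB, hhh, map_smul]
  rfl

omit hJ in
lemma tau_surj (g : SymA) : ∃ f, tau f = g := by
  refine ⟨aeval (fun k : ℕ+ => (X k - if k = 1 then 1 else 0 : SymA)) g, ?_⟩
  have : tau.comp (aeval (fun k : ℕ+ => (X k - if k = 1 then 1 else 0 : SymA))) = AlgHom.id F _ := by
    refine algHom_ext fun k => ?_
    rw [AlgHom.comp_apply, aeval_X, map_sub, tau, aeval_X]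
    split_ifs <;> simp
  exact AlgHom.congr_fun this g

lemma Th_inj {f : SymA} (h : Th J f = 0) : f = 0 := by
  have h1 : ∀ g, hallL (tau g) f = 0 := by
    intro g
    obtain ⟨S, c, rfl⟩ := J_span_all hJ g
    rw [map_sum, map_sum, LinearMap.sum_apply]
    refine Finset.sum_eq_zero fun mu _ => ?_
    rw [map_smul, map_smul, LinearMap.smul_apply, ← Th_apply, h]
    simp
  ext m
  obtain ⟨g, hg⟩ := tau_surj (monomial m 1)
  have := h1 g
  rw [hg, hallL_monomial_left, one_mul] at this
  rw [coeff_zero]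
  exact (mul_eq_zero.1 this).resolve_right (zalpha_ne_zero m)

omit hJ in
lemma coeff_tau (e : Exp) (f : SymA) : coeff e (tau f) =
    ∑ m ∈ f.support, if m.erase 1 = e.erase 1 then coeff m f * ((Nat.choose (m 1) (e 1) : ℕ) : F)
      else 0 := by
  have hf : tau f = ∑ m ∈ f.support, coeff m f • tau (monomial m 1) := by
    conv_lhs => rw [f.as_sum]
    rw [map_sum]
    refine Finset.sum_congr rfl fun m _ => ?_
    rw [← map_smul, smul_monomial, smul_eq_mul, mul_one]
  rw [hf, coeff_sum]
  refine Finset.sum_congr rfl fun m _ => ?_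
  have key : ∀ j, (m.erase 1 + Finsupp.single 1 j = e) ↔ (m.erase 1 = e.erase 1 ∧ j = e 1) := by
    intro j
    constructor
    · rintro rfl
      constructor
      · ext i
        by_cases hi : i = 1
        · subst hi; simp
        · simp [Finsupp.erase_ne hi, Finsupp.single_apply, Ne.symm hi]
      · simp
    · rintro ⟨h1, rfl⟩
      rw [h1, Finsupp.erase_add_single]
  rw [coeff_smul, tau_monomial, coeff_sum]
  simp only [coeff_monomial, key]
  split_ifs with h
  · simp only [h, true_and, Finset.sum_ite_eq', Finset.mem_range]
    split_ifs with h2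
    · rfl
    · rw [Nat.choose_eq_zero_of_lt (by omega)]; simp
  · simp [h]

lemma theta_eq (mu lam : JPartition) : theta J mu lam = coeff (toExp mu) (tau (J lam)) := by
  have hwt : ∀ m : Exp, wt m = wt (m.erase 1) + m 1 := by
    intro m
    conv_lhs => rw [← Finsupp.erase_add_single 1 m]
    rw [wt_add, wt_single]; simp
  rw [theta, coeff_tau]
  split_ifs with h
  · symm
    refine Finset.sum_eq_zero fun m hm => ?_
    split_ifs with h1
    · have h2 := J_homog hJ (mem_support_iff.1 hm)
      have h3 := hwt m
      have h4 := hwt (toExp mu)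
      rw [h1] at h3
      rw [wt_toExp] at h4
      rw [Nat.choose_eq_zero_of_lt (by omega)]; simp
    · rfl
  · set e := toExp (addOnes mu (psize lam - psize mu)) with he
    have he' : e = toExp mu + Finsupp.single 1 (psize lam - psize mu) := by
      rw [he, addOnes, toExp_add, toExp_replicate]
    have hee : e.erase 1 = (toExp mu).erase 1 := by
      ext i
      by_cases hi : i = 1
      · subst hi; simp
      · rw [he']
        simp [Finsupp.erase_ne hi, Finsupp.single_apply, Ne.symm hi]
    have he1 : e 1 = psize lam - psize mu + pmult mu 1 := by
      rw [he', Finsupp.add_apply, toExp_apply, Finsupp.single_eq_same, pmult, add_comm]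
    rw [Finset.sum_eq_single e]
    · rw [if_pos hee, he1, toExp_apply, ← pmult, mul_comm]
    · intro m hm hne
      rw [if_neg]
      intro h1
      apply hne
      have h2 := J_homog hJ (mem_support_iff.1 hm)
      have h3 := hwt m
      have h4 := hwt (toExp mu)
      rw [h1] at h3
      rw [wt_toExp, toExp_apply, ← pmult] at h4
      have h5 : m 1 = e 1 := by omega
      rw [← Finsupp.erase_add_single 1 m, ← Finsupp.erase_add_single 1 e, h1, hee, h5]
    · intro hn
      rw [notMem_support_iff.1 hn]; simp

lemma Th_one : Th J 1 = 1 := by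
  funext lam
  have h1 : (1 : SymA) = monomial 0 1 := rfl
  have h2 := theta_eq hJ 0 lam
  rw [toExp_zero] at h2
  rw [Th_apply, h1, hallL_monomial_right, ← h2, zalpha_zero, theta]
  have h3 : psize 0 = 0 := by simp [psize_eq]
  rw [h3, if_neg (by omega)]
  have h4 : toExp (addOnes 0 (psize lam - 0)) = Finsupp.single 1 (psize lam) := by
    rw [addOnes, zero_add, toExp_replicate, Nat.sub_zero]
  rw [h4, hJ.normalized]
  simp [pmult]

lemma theta_Th (mu lam : JPartition) :
    theta J mu lam * zalpha (toExp mu) = Th J (monomial (toExp mu) 1) lam := by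
  rw [theta_eq hJ, Th_apply, hallL_monomial_right, one_mul]

/-- the key formula for structure coefficients -/
lemma struct_key {g : JPartition → JPartition → JPartition → F} (hg : IsStructCoeffs J g)
    (mu nu : JPartition) : ∃ H : SymA,
    (∀ pi, g pi mu nu * (zalpha (toExp mu) * zalpha (toExp nu)) =
      hallL (monomial (toExp pi) 1) H) ∧
    H - monomial (toExp mu) 1 * monomial (toExp nu) 1
      - BB (monomial (toExp mu) 1) (monomial (toExp nu) 1) ∈
      Fil ((psize mu : ℤ) + psize nu - 2) := by
  obtain ⟨hh, hU⟩ := Th_UU hJ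
  have hgood := good_monomial (Th J) hh (Th_one hJ) hU (psize mu) (toExp mu) (wt_toExp mu)
  obtain ⟨H, h1, h2⟩ := hgood (psize nu) (monomial (toExp nu) 1)
    (monomial_mem_Fil (by rw [wt_toExp]))
  refine ⟨H, ?_, h2⟩
  set z := zalpha (toExp mu) * zalpha (toExp nu) with hz
  have hfin := hg.1 mu nu
  set H' : SymA := ∑ pi ∈ hfin.toFinset, monomial (toExp pi)
    (g pi mu nu * z * (zalpha (toExp pi))⁻¹) with hH'
  have hTh : Th J H' = Th J H := by
    rw [h1]
    funext lam
    have e1 : Th J H' lam = ∑ pi ∈ hfin.toFinset, g pi mu nu * z * theta J pi lam := by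
      rw [hH', map_sum, Finset.sum_apply]
      refine Finset.sum_congr rfl fun pi _ => ?_
      rw [Th_apply, hallL_monomial_right, theta_eq hJ]
      field_simp [zalpha_ne_zero (toExp pi)]
    have e2 := hg.2 mu nu lam
    rw [finsum_eq_sum_of_support_subset (s := hfin.toFinset)] at e2
    · rw [e1, Pi.mul_apply, ← theta_Th hJ, ← theta_Th hJ, hz]
      have : ∀ pi ∈ hfin.toFinset, g pi mu nu * (zalpha (toExp mu) * zalpha (toExp nu)) *
          theta J pi lam
          = (zalpha (toExp mu) * zalpha (toExp nu)) * (g pi mu nu * theta J pi lam) := by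
        intros; ring
      rw [Finset.sum_congr rfl this, ← Finset.mul_sum, ← e2]
      ring
    · intro pi hpi
      rw [Function.mem_support] at hpi
      simp only [Set.Finite.coe_toFinset, Set.mem_setOf_eq]
      exact left_ne_zero_of_mul hpi
  have hHH : H' = H := by
    rw [← sub_eq_zero]
    refine Th_inj hJ ?_
    rw [map_sub, hTh, sub_self]
  intro pi
  rw [hallL_monomial_left, one_mul, ← hHH, hH', coeff_sum]
  simp only [coeff_monomial, toExp_injective.eq_iff, Finset.sum_ite_eq', Set.Finite.mem_toFinset,
    Set.mem_setOf_eq]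
  split_ifs with h
  · field_simp [zalpha_ne_zero (toExp pi)]
  · rw [not_not.1 h]; simp

end jack

end JA

namespace JA
open MvPolynomial

/-! ### the pairing with `ℚ(α)[q,r]` -/

abbrev QExp : Type := (ℕ+ ⊕ ℕ+) →₀ ℕ

def eE : QExp ≃+ Exp × Exp := Finsupp.sumFinsuppAddEquivProdFinsupp

lemma eE_inl (k : ℕ+) : eE (Finsupp.single (Sum.inl k) 1) = (Finsupp.single k 1, 0) := by
  ext i
  · simp [eE, Finsupp.single_apply]
  · simp [eE, Finsupp.single_apply]

lemma eE_inr (k : ℕ+) : eE (Finsupp.single (Sum.inr k) 1) = (0, Finsupp.single k 1) := by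
  ext i
  · simp [eE, Finsupp.single_apply]
  · simp [eE, Finsupp.single_apply]

def CC (a b : SymA) : QR →ₗ[F] F :=
  (basisMonomials (ℕ+ ⊕ ℕ+) F).constr F
    (fun e => hallL (monomial (eE e).1 1) a * hallL (monomial (eE e).2 1) b)

lemma CC_monomial (a b : SymA) (e : QExp) : CC a b (monomial e 1) =
    hallL (monomial (eE e).1 1) a * hallL (monomial (eE e).2 1) b := by
  have := (basisMonomials (ℕ+ ⊕ ℕ+) F).constr_basis F
    (fun e => hallL (monomial (eE e).1 1) a * hallL (monomial (eE e).2 1) b) e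
  rw [coe_basisMonomials] at this
  exact this

lemma CC_q (a b : SymA) (k : ℕ+) (Q : QR) : CC a b (qv k * Q) = CC (dd k a) b Q := by
  have : CC a b ∘ₗ LinearMap.mulLeft F (qv k) = CC (dd k a) b := by
    refine lin_ext fun e => ?_
    rw [LinearMap.comp_apply, LinearMap.mulLeft_apply, qv, X, monomial_mul, one_mul, CC_monomial,
      CC_monomial, map_add, eE_inl, ← hall_adj1, pp_pnat, X, monomial_mul, one_mul]
    simp
  exact LinearMap.congr_fun this Q

lemma CC_r (a b : SymA) (k : ℕ+) (Q : QR) : CC a b (rv k * Q) = CC a (dd k b) Q := by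
  have : CC a b ∘ₗ LinearMap.mulLeft F (rv k) = CC a (dd k b) := by
    refine lin_ext fun e => ?_
    rw [LinearMap.comp_apply, LinearMap.mulLeft_apply, rv, X, monomial_mul, one_mul, CC_monomial,
      CC_monomial, map_add, eE_inr, ← hall_adj1, pp_pnat, X, monomial_mul, one_mul]
    simp
  exact LinearMap.congr_fun this Q

lemma CC_add_left (a a' b : SymA) (Q : QR) : CC (a + a') b Q = CC a b Q + CC a' b Q := by
  have : CC (a + a') b = CC a b + CC a' b := by
    refine lin_ext fun e => ?_
    rw [LinearMap.add_apply, CC_monomial, CC_monomial, CC_monomial, map_add, add_mul]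
  rw [this]; rfl

lemma CC_coeff (Q : QR) (e : QExp) : CC (monomial (eE e).1 1) (monomial (eE e).2 1) Q =
    coeff e Q * (zalpha (eE e).1 * zalpha (eE e).2) := by
  have : CC (monomial (eE e).1 1) (monomial (eE e).2 1) =
      (zalpha (eE e).1 * zalpha (eE e).2) • MvPolynomial.lcoeff F e := by
    refine lin_ext fun e' => ?_
    rw [CC_monomial, hallL_monomial_left, hallL_monomial_left, LinearMap.smul_apply, lcoeff_apply,
      coeff_monomial, coeff_monomial, coeff_monomial]
    by_cases h : e' = e
    · subst h; simp
    · rw [if_neg h]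
      by_cases h1 : (eE e).1 = (eE e').1
      · rw [if_neg (c := (eE e).2 = (eE e').2)]
        · simp
        · intro h2
          exact h (eE.injective (Prod.ext h1 h2)).symm
      · rw [if_neg h1]; simp
  rw [this, LinearMap.smul_apply, lcoeff_apply, smul_eq_mul, mul_comm]

lemma CC_inj {P Q : QR} (h : ∀ mu nu : JPartition, CC (monomial (toExp mu) 1) (monomial (toExp nu) 1) P =
    CC (monomial (toExp mu) 1) (monomial (toExp nu) 1) Q) : P = Q := by
  ext e
  have := h (toPart (eE e).1) (toPart (eE e).2)
  rw [toExp_toPart, toExp_toPart, CC_coeff, CC_coeff] at this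
  exact mul_right_cancel₀ (mul_ne_zero (zalpha_ne_zero _) (zalpha_ne_zero _)) this

lemma pPow_eq (l : JPartition) : pPow l = monomial (toExp l) 1 := by
  induction l using Multiset.induction with
  | empty => simp [pPow, toExp_zero]
  | cons i l ih =>
    rw [pPow, Multiset.map_cons, Multiset.prod_cons, ← pPow, ih, toExp_cons, X, monomial_mul, one_mul]

lemma qrMon_eq (mu nu : JPartition) : qrMon mu nu = monomial (eE.symm (toExp mu, toExp nu)) 1 := by
  have h1 : ∀ l : JPartition, (l.map fun i => qv i).prod = monomial (eE.symm (toExp l, 0)) 1 := by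
    intro l
    induction l using Multiset.induction with
    | empty =>
      rw [toExp_zero]
      have : ((0, 0) : Exp × Exp) = 0 := rfl
      rw [this, map_zero]; simp
    | cons i l ih =>
      rw [Multiset.map_cons, Multiset.prod_cons, ih, toExp_cons, qv, X, monomial_mul, one_mul]
      congr 2
      apply eE.injective
      rw [map_add, eE_inl]; simp
  have h2 : ∀ l : JPartition, (l.map fun i => rv i).prod = monomial (eE.symm (0, toExp l)) 1 := by
    intro l
    induction l using Multiset.induction with
    | empty =>
      rw [toExp_zero]
      have : ((0, 0) : Exp × Exp) = 0 := rfl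
      rw [this, map_zero]; simp
    | cons i l ih =>
      rw [Multiset.map_cons, Multiset.prod_cons, ih, toExp_cons, rv, X, monomial_mul, one_mul]
      congr 2
      apply eE.injective
      rw [map_add, eE_inr]; simp
  rw [qrMon, h1, h2, monomial_mul, one_mul, ← map_add]
  simp

lemma CC_qrMon (mu nu mu' nu' : JPartition) :
    CC (monomial (toExp mu) 1) (monomial (toExp nu) 1) (qrMon mu' nu') =
    if mu' = mu ∧ nu' = nu then zalpha (toExp mu) * zalpha (toExp nu) else 0 := by
  rw [qrMon_eq, CC_monomial, AddEquiv.apply_symm_apply, hallL_monomial_left, hallL_monomial_left,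
    coeff_monomial, coeff_monomial]
  by_cases h : mu' = mu
  · by_cases h' : nu' = nu
    · subst h; subst h'; simp
    · have : toExp nu ≠ toExp nu' := fun h2 => h' (toExp_injective h2).symm
      simp [h', this]
  · have : toExp mu ≠ toExp mu' := fun h2 => h (toExp_injective h2).symm
    simp [h, this]

/-! ### `Ψ` -/

def PsiA : SymA →ₐ[F] QR := aeval fun k => qv k + rv k

lemma PsiA_monomial (m : Exp) :
    PsiA (monomial m 1) = ((toPart m).map fun i => qv i + rv i).prod := by
  rw [← toExp_toPart m, ← pPow_eq, pPow, map_multiset_prod, Multiset.map_map, toPart_toExp]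
  congr 1
  refine Multiset.map_congr rfl fun i _ => ?_
  simp [PsiA]

lemma sum_support (f : SymA) : f = ∑ m ∈ f.support, coeff m f • (monomial m 1 : SymA) := by
  conv_lhs => rw [f.as_sum]
  refine Finset.sum_congr rfl fun m _ => ?_
  rw [smul_monomial, smul_eq_mul, mul_one]

lemma Psi_eq (f : SymA) : Psi f = PsiA f := by
  conv_rhs => rw [sum_support f]
  rw [map_sum, Psi]
  refine Finset.sum_congr rfl fun m _ => ?_
  rw [map_smul, PsiA_monomial]

lemma dd_mul (t : ℕ) (a b : SymA) : dd t (a * b) = a * dd t b + b * dd t a := by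
  rcases Nat.eq_zero_or_pos t with h | h
  · subst h; simp [dd_zero]
  · have := dd_pnat (Nat.toPNat t h)
    have h2 : ((Nat.toPNat t h : ℕ+) : ℕ) = t := rfl
    rw [h2] at this
    rw [this, this, this, Derivation.leibniz, smul_add, smul_eq_mul, smul_eq_mul, mul_smul_comm,
      mul_smul_comm]

lemma hall_mul_eq (f a b : SymA) : hallL f (a * b) = CC a b (PsiA f) := by
  have : ∀ (l : JPartition) (a b : SymA), hallL (pPow l) (a * b) = CC a b (PsiA (pPow l)) := by
    intro l
    induction l using Multiset.induction with
    | empty =>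
      intro a b
      have h1 : pPow 0 = 1 := by simp [pPow]
      have h2 : (1 : SymA) = monomial 0 1 := rfl
      have h3 : (1 : QR) = monomial 0 1 := rfl
      rw [h1, map_one PsiA, h3, CC_monomial, map_zero, h2, Prod.fst_zero, Prod.snd_zero,
        hallL_monomial_left, hallL_monomial_left, hallL_monomial_left, zalpha_zero]
      have := map_mul (constantCoeff (σ := ℕ+) (R := F)) a b
      rw [constantCoeff_eq] at this
      rw [this]; ring
    | cons i l ih =>
      intro a b
      have h1 : pPow (i ::ₘ l) = X i * pPow l := by
        rw [pPow, Multiset.map_cons, Multiset.prod_cons, ← pPow]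
      have h2 : PsiA (X i) = qv i + rv i := by simp [PsiA]
      rw [h1, map_mul PsiA, h2, add_mul, map_add, CC_q, CC_r, ← ih, ← ih, ← pp_pnat, hall_adj1, dd_mul,
        map_add, mul_comm b, add_comm]
  have h2 : (hallL.flip (a * b)) = CC a b ∘ₗ PsiA.toLinearMap := by
    refine lin_ext fun m => ?_
    have := this (toPart m) a b
    rw [pPow_eq, toExp_toPart] at this
    exact this
  exact LinearMap.congr_fun h2 f

/-! ### the first order operator -/

def qq (t : ℕ) : QR := if h : 0 < t then qv (Nat.toPNat t h) else 0
def rr (t : ℕ) : QR := if h : 0 < t then rv (Nat.toPNat t h) else 0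

lemma CC_zero_left (b : SymA) (Q : QR) : CC 0 b Q = 0 := by
  have := CC_add_left 0 0 b Q
  rw [add_zero] at this
  exact left_eq_add.1 this

lemma CC_zero_right (a : SymA) (Q : QR) : CC a 0 Q = 0 := by
  have : CC a 0 = 0 := by
    refine lin_ext fun e => ?_
    rw [CC_monomial]; simp
  rw [this]; rfl

lemma CC_qq (a b : SymA) (t : ℕ) (Q : QR) : CC a b (qq t * Q) = CC (dd t a) b Q := by
  rcases Nat.eq_zero_or_pos t with h | h
  · subst h; simp [dd_zero, qq, CC_zero_left]
  · rw [qq, dif_pos h, CC_q]; rfl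

lemma CC_rr (a b : SymA) (t : ℕ) (Q : QR) : CC a b (rr t * Q) = CC a (dd t b) Q := by
  rcases Nat.eq_zero_or_pos t with h | h
  · subst h; simp [dd_zero, rr, CC_zero_right]
  · rw [rr, dif_pos h, CC_r]; rfl

lemma dd_large (f : SymA) : ∃ M : ℕ, ∀ t, M ≤ t → dd t f = 0 := by
  refine ⟨(nabla f).natDegree + 1, fun t ht => ?_⟩
  rw [← coeff_nabla]
  exact Polynomial.coeff_eq_zero_of_natDegree_lt (by omega)

def Op (M : ℕ) (f : SymA) : QR := ∑ m ∈ Finset.range M,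
  ∑ x ∈ Finset.HasAntidiagonal.antidiagonal (m + 1), qq x.1 * rr x.2 * PsiA (alpha⁻¹ • dd m f)

lemma ppi'_sum (G : VY) (N : ℕ) (hN : G.natDegree < N + 1) :
    ppi' G = ∑ m ∈ Finset.range N, pp m * G.coeff (m + 1) := by
  conv_lhs => rw [G.as_sum_range' (N + 1) hN]
  rw [map_sum, Finset.sum_range_succ']
  rw [ppi'_monomial, Nat.zero_sub, pp_zero, mul_zero, add_zero]
  refine Finset.sum_congr rfl fun m _ => ?_
  rw [ppi'_monomial, Nat.add_sub_cancel, mul_comm]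

lemma CC_Op (M : ℕ) (f a b : SymA) (hM : ∀ t, M ≤ t → dd t f = 0) :
    CC a b (Op M f) = hallL f (BB a b) := by
  set G := nabla a * nabla b with hG
  set N := max M G.natDegree
  have h1 : CC a b (Op M f) =
      ∑ m ∈ Finset.range M, alpha⁻¹ * hallL f (pp m * G.coeff (m + 1)) := by
    rw [Op, map_sum]
    refine Finset.sum_congr rfl fun m _ => ?_
    rw [map_sum, hG, Polynomial.coeff_mul, ← hall_adj2, map_sum, Finset.mul_sum]
    refine Finset.sum_congr rfl fun x _ => ?_
    rw [mul_assoc, CC_qq, CC_rr, ← hall_mul_eq, map_smul, LinearMap.smul_apply, coeff_nabla,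
      coeff_nabla, smul_eq_mul]
  have h2 : ∑ m ∈ Finset.range M, alpha⁻¹ * hallL f (pp m * G.coeff (m + 1)) =
      ∑ m ∈ Finset.range N, alpha⁻¹ * hallL f (pp m * G.coeff (m + 1)) := by
    refine Finset.sum_subset (Finset.range_subset_range.2 (le_max_left _ _)) fun m _ hm => ?_
    rw [← hall_adj2, hM m (by simpa using hm), map_zero, LinearMap.zero_apply, mul_zero]
  rw [h1, h2, ← Finset.mul_sum, ← map_sum, ← ppi'_sum G N (Nat.lt_succ_of_le (le_max_right _ _)), BB, map_smul,
    smul_eq_mul]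

lemma finsum_pnat {M : Type*} [AddCommMonoid M] (G : ℕ → M) (N : ℕ) (h0 : G 0 = 0)
    (hN : ∀ t, N ≤ t → G t = 0) : ∑ᶠ m : ℕ+, G (m : ℕ) = ∑ i ∈ Finset.range N, G i := by
  rw [← finsum_mem_range (f := G) (g := fun m : ℕ+ => (m : ℕ)) PNat.coe_injective]
  apply finsum_mem_eq_sum_of_inter_support_eq
  ext i
  simp only [Set.mem_inter_iff, Set.mem_range, Function.mem_support, Finset.coe_range, Set.mem_Iio]
  constructor
  · rintro ⟨_, h⟩
    exact ⟨by by_contra hc; exact h (hN i (by omega)), h⟩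
  · rintro ⟨_, h⟩
    have : 0 < i := Nat.pos_of_ne_zero fun h' => h (h' ▸ h0)
    exact ⟨⟨Nat.toPNat i this, rfl⟩, h⟩

lemma qq_pnat (m : ℕ+) : qq m = qv m := by rw [qq, dif_pos m.pos]; rfl
lemma rr_pnat (m : ℕ+) : rr m = rv m := by rw [rr, dif_pos m.pos]; rfl
lemma qq_zero : qq 0 = 0 := by simp [qq]
lemma rr_zero : rr 0 = 0 := by simp [rr]

lemma finsum_anti (n : ℕ) (T : QR) :
    (∑ᶠ m1 : ℕ+, ∑ᶠ m2 : ℕ+, if (m1 : ℕ) + (m2 : ℕ) = n then qv m1 * rv m2 * T else 0) =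
    ∑ x ∈ Finset.HasAntidiagonal.antidiagonal n, qq x.1 * rr x.2 * T := by
  have h1 : ∀ m1 : ℕ+, (∑ᶠ m2 : ℕ+, if (m1 : ℕ) + (m2 : ℕ) = n then qv m1 * rv m2 * T else 0) =
      (fun i : ℕ => if i ≤ n then qq i * rr (n - i) * T else 0) m1 := by
    intro m1
    have : ∀ m2 : ℕ+, (if (m1 : ℕ) + (m2 : ℕ) = n then qv m1 * rv m2 * T else 0) =
      (fun j : ℕ => if (m1 : ℕ) + j = n then qq m1 * rr j * T else 0) m2 := fun m2 => by
        simp only [qq_pnat, rr_pnat]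
    rw [finsum_congr this, finsum_pnat (fun j : ℕ => if (m1 : ℕ) + j = n then qq m1 * rr j * T else 0) (n + 1) (by simp [rr_zero])
      (fun t ht => if_neg (by omega))]
    by_cases h : (m1 : ℕ) ≤ n
    · rw [Finset.sum_eq_single (n - m1)]
      · beta_reduce
        rw [if_pos (by omega), if_pos h]
      · intro j _ hj
        exact if_neg (by omega)
      · intro hh; exfalso; apply hh; simp
    · beta_reduce
      rw [if_neg h]
      exact Finset.sum_eq_zero fun j _ => if_neg (by omega)
  rw [finsum_congr h1, finsum_pnat (fun i : ℕ => if i ≤ n then qq i * rr (n - i) * T else 0) (n + 1) (by simp [qq_zero]) (fun t ht => if_neg (by omega)),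
    Finset.Nat.sum_antidiagonal_eq_sum_range_succ_mk]
  refine Finset.sum_congr rfl fun i hi => ?_
  exact if_pos (by simpa [Nat.lt_succ_iff] using hi)

lemma rhs_eq (f : SymA) (M : ℕ) (hM : ∀ t, M ≤ t → dd t f = 0) :
    (∑ᶠ m : ℕ+, ∑ᶠ m1 : ℕ+, ∑ᶠ m2 : ℕ+,
        if (m1 : ℕ) + (m2 : ℕ) = (m : ℕ) + 1 then
          qv m1 * rv m2 * Psi (((m : ℕ) : F) • MvPolynomial.pderiv m f)
        else 0) = Op M f := by
  have h1 : ∀ m : ℕ+, (∑ᶠ m1 : ℕ+, ∑ᶠ m2 : ℕ+,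
        if (m1 : ℕ) + (m2 : ℕ) = (m : ℕ) + 1 then
          qv m1 * rv m2 * Psi (((m : ℕ) : F) • MvPolynomial.pderiv m f)
        else 0) = (fun i : ℕ => ∑ x ∈ Finset.HasAntidiagonal.antidiagonal (i + 1),
          qq x.1 * rr x.2 * PsiA (alpha⁻¹ • dd i f)) m := by
    intro m
    rw [finsum_anti, Psi_eq]
    beta_reduce
    rw [dd_pnat, smul_smul, inv_mul_cancel_left₀ alpha_ne_zero]
  rw [finsum_congr h1, finsum_pnat (fun i : ℕ => ∑ x ∈ Finset.HasAntidiagonal.antidiagonal (i + 1),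
          qq x.1 * rr x.2 * PsiA (alpha⁻¹ • dd i f)) M (by simp [dd_zero]), Op]
  intro t ht
  simp [hM t ht]

/-! ### homogeneity of the bracket -/

def HH (d : ℤ) : Submodule F SymA := weightedHomogeneousSubmodule F (fun i : ℕ+ => ((i : ℕ) : ℤ)) d

lemma weight_eq (m : Exp) : Finsupp.weight (fun i : ℕ+ => ((i : ℕ) : ℤ)) m = wt m := by
  rw [Finsupp.weight_apply, wt, Finsupp.sum, Finsupp.sum]
  push_cast
  simp

lemma HH_mul {d e : ℤ} {f g : SymA} (hf : f ∈ HH d) (hg : g ∈ HH e) : f * g ∈ HH (d + e) :=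
  IsWeightedHomogeneous.mul hf hg

lemma HH_coeff {d : ℤ} {f : SymA} (hf : f ∈ HH d) {m : Exp} (h : (wt m : ℤ) ≠ d) :
    coeff m f = 0 := by
  by_contra hc
  exact h (by rw [← weight_eq]; exact hf hc)

lemma HH_monomial (m : Exp) (c : F) : monomial m c ∈ HH (wt m) :=
  isWeightedHomogeneous_monomial _ _ _ (weight_eq m)

lemma HH_X (i : ℕ+) : (X i : SymA) ∈ HH i := isWeightedHomogeneous_X F _ i

lemma psize_cons (i : ℕ+) (l : JPartition) : psize (i ::ₘ l) = i + psize l := by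
  rw [psize_eq, psize_eq]; simp

lemma pPow_cons (i : ℕ+) (l : JPartition) : pPow (i ::ₘ l) = X i * pPow l := by
  rw [pPow, Multiset.map_cons, Multiset.prod_cons, ← pPow]

lemma HH_pPow (l : JPartition) : pPow l ∈ HH (psize l) := by
  rw [pPow_eq, ← wt_toExp]; exact HH_monomial _ _

lemma BB_X_X (i j : ℕ+) : BB (X i) (X j) ∈ HH ((i : ℤ) + j - 1) := by
  rw [BB, nabla_X, nabla_X, smul_mul_smul_comm, ← pow_add, LinearMap.map_smul_of_tower,
    ← Polynomial.monomial_one_right_eq_X_pow, ppi'_monomial, one_mul]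
  refine Submodule.smul_mem _ _ (Submodule.smul_mem _ _ ?_)
  have hi := i.2
  have hj := j.2
  have h : 0 < (i : ℕ) + j - 1 := by have : 0 < (i : ℕ) := hi; have : 0 < (j : ℕ) := hj; omega
  have h2 := HH_X (Nat.toPNat _ h)
  rw [pp, dif_pos h]
  convert h2 using 2
  have h3 : ((Nat.toPNat _ h : ℕ+) : ℕ) = (i : ℕ) + j - 1 := rfl
  rw [h3]; push_cast [show 1 ≤ (i : ℕ) + j by omega]; ring

lemma BB_X_pPow (i : ℕ+) (l : JPartition) : BB (X i) (pPow l) ∈ HH ((i : ℤ) + psize l - 1) := by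
  induction l using Multiset.induction with
  | empty =>
    have h1 : pPow 0 = 1 := by simp [pPow]
    rw [h1, BB_comm, BB_one_left]; exact zero_mem _
  | cons j l ih =>
    rw [pPow_cons, BB_mul_right, psize_cons]
    refine add_mem ?_ ?_
    · convert HH_mul (HH_X j) ih using 2; push_cast; ring
    · convert HH_mul (HH_pPow l) (BB_X_X i j) using 2; push_cast; ring

lemma BB_pPow_pPow (k l : JPartition) : BB (pPow k) (pPow l) ∈ HH ((psize k : ℤ) + psize l - 1) := by
  induction k using Multiset.induction with
  | empty =>
    have h1 : pPow 0 = 1 := by simp [pPow]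
    rw [h1, BB_one_left]; exact zero_mem _
  | cons j k ih =>
    rw [pPow_cons, BB_mul_left, psize_cons]
    refine add_mem ?_ ?_
    · convert HH_mul (HH_X j) ih using 2; push_cast; ring
    · convert HH_mul (HH_pPow k) (BB_X_pPow j l) using 2; push_cast; ring

/-! ### conclusion -/

def Gt (g : JPartition → JPartition → JPartition → F) (n : ℕ) (pi : JPartition) : QR :=
  ∑ᶠ mu : JPartition, ∑ᶠ nu : JPartition,
      if psize mu + psize nu = n then g pi mu nu • qrMon mu nu else 0

lemma CC_Gt (g : JPartition → JPartition → JPartition → F) (n : ℕ) (pi mu nu : JPartition) :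
    CC (monomial (toExp mu) 1) (monomial (toExp nu) 1) (Gt g n pi) =
    if psize mu + psize nu = n then g pi mu nu * (zalpha (toExp mu) * zalpha (toExp nu)) else 0 := by
  set S := (finite_psize_le n).toFinset with hS
  have hmem : ∀ l, l ∈ S ↔ psize l ≤ n := fun l => by rw [hS, Set.Finite.mem_toFinset]; rfl
  have h1 : Gt g n pi = ∑ mu ∈ S, ∑ nu ∈ S,
      if psize mu + psize nu = n then g pi mu nu • qrMon mu nu else 0 := by
    have h2 : ∀ mu, (∑ᶠ nu : JPartition,
        if psize mu + psize nu = n then g pi mu nu • qrMon mu nu else 0) = ∑ nu ∈ S,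
        if psize mu + psize nu = n then g pi mu nu • qrMon mu nu else 0 := by
      intro mu
      apply finsum_eq_sum_of_support_subset
      intro nu hnu
      rw [Finset.mem_coe, hmem]
      by_contra hc
      exact hnu (if_neg (by omega))
    rw [Gt, finsum_congr h2]
    apply finsum_eq_sum_of_support_subset
    intro mu hmu
    rw [Finset.mem_coe, hmem]
    by_contra hc
    exact hmu (Finset.sum_eq_zero fun nu _ => if_neg (by omega))
  rw [h1, map_sum]
  have h3 : ∀ mu' ∈ S, CC (monomial (toExp mu) 1) (monomial (toExp nu) 1) (∑ nu' ∈ S,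
      if psize mu' + psize nu' = n then g pi mu' nu' • qrMon mu' nu' else 0) = ∑ nu' ∈ S,
      if mu' = mu ∧ nu' = nu then (if psize mu + psize nu = n then
        g pi mu nu * (zalpha (toExp mu) * zalpha (toExp nu)) else 0) else 0 := by
    intro mu' _
    rw [map_sum]
    refine Finset.sum_congr rfl fun nu' _ => ?_
    rw [apply_ite (CC _ _), map_zero, map_smul, CC_qrMon]
    by_cases h : mu' = mu ∧ nu' = nu
    · rw [if_pos h, if_pos h, h.1, h.2, smul_eq_mul]
    · rw [if_neg h, if_neg h, smul_zero, ite_self]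
  rw [Finset.sum_congr rfl h3]
  by_cases h : psize mu + psize nu = n
  · rw [Finset.sum_eq_single mu, Finset.sum_eq_single nu]
    · simp
    · intro b _ hb; exact if_neg fun h => hb h.2
    · intro hh; exact absurd ((hmem nu).2 (by omega)) hh
    · intro b _ hb; exact Finset.sum_eq_zero fun c _ => if_neg fun h => hb h.1
    · intro hh; exact absurd ((hmem mu).2 (by omega)) hh
  · rw [if_neg h]
    simp

lemma hall_Fil {d : ℤ} {f : SymA} (hf : f ∈ Fil d) {m : Exp} (h : d < wt m) :
    hallL (monomial m 1) f = 0 := by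
  rw [hallL_monomial_left]
  have : coeff m f = 0 := by
    by_contra hc
    exact absurd (hf m hc) (by omega)
  rw [this]; ring

lemma hall_HH {d : ℤ} {f : SymA} (hf : f ∈ HH d) {m : Exp} (h : (wt m : ℤ) ≠ d) :
    hallL (monomial m 1) f = 0 := by
  rw [hallL_monomial_left, HH_coeff hf h]; ring

section
variable {J : JPartition → SymA} (hJ : IsJackFamily J)
  {g : JPartition → JPartition → JPartition → F} (hg : IsStructCoeffs J g)

lemma mon_mul_HH (mu nu : JPartition) : (monomial (toExp mu) (1 : F) : SymA) * monomial (toExp nu) 1 ∈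
    HH ((psize mu : ℤ) + psize nu) := by
  rw [← pPow_eq, ← pPow_eq]; exact HH_mul (HH_pPow _) (HH_pPow _)

lemma mon_BB_HH (mu nu : JPartition) : BB (monomial (toExp mu) 1) (monomial (toExp nu) 1) ∈
    HH ((psize mu : ℤ) + psize nu - 1) := by
  rw [← pPow_eq, ← pPow_eq]; exact BB_pPow_pPow _ _

include hJ hg

lemma g_zero (pi mu nu : JPartition) :
    CC (monomial (toExp mu) 1) (monomial (toExp nu) 1) (Gt g (psize pi) pi) =
    hallL (monomial (toExp pi) 1) (monomial (toExp mu) 1 * monomial (toExp nu) 1) := by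
  rw [CC_Gt]
  obtain ⟨H, h1, h2⟩ := struct_key hJ hg mu nu
  split_ifs with h
  · rw [h1]
    have h3 := hall_Fil h2 (m := toExp pi) (by rw [wt_toExp]; omega)
    have h4 := hall_HH (mon_BB_HH mu nu) (m := toExp pi) (by rw [wt_toExp]; omega)
    rw [map_sub, map_sub, h4, sub_zero, sub_eq_zero] at h3
    exact h3
  · rw [hall_HH (mon_mul_HH mu nu)]
    rw [wt_toExp]; omega

lemma g_one (pi mu nu : JPartition) :
    CC (monomial (toExp mu) 1) (monomial (toExp nu) 1) (Gt g (psize pi + 1) pi) =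
    hallL (monomial (toExp pi) 1) (BB (monomial (toExp mu) 1) (monomial (toExp nu) 1)) := by
  rw [CC_Gt]
  obtain ⟨H, h1, h2⟩ := struct_key hJ hg mu nu
  split_ifs with h
  · rw [h1]
    have h3 := hall_Fil h2 (m := toExp pi) (by rw [wt_toExp]; omega)
    have h4 := hall_HH (mon_mul_HH mu nu) (m := toExp pi) (by rw [wt_toExp]; omega)
    rw [map_sub, map_sub, h4, sub_zero, sub_eq_zero] at h3
    exact h3
  · rw [hall_HH (mon_BB_HH mu nu)]
    rw [wt_toExp]; omega

omit hJ hg in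
lemma Gk_eq (k : ℕ) (f : SymA) :
    Gk g k f = ∑ m ∈ f.support, coeff m f • Gt g (psize (toPart m) + k) (toPart m) := by
  rw [Gk]
  refine Finset.sum_congr rfl fun m _ => ?_
  rw [psize_toPart, Gt]

omit hJ hg in
lemma CC_Gk (k : ℕ) (f a b h : SymA)
    (H : ∀ pi : JPartition, CC a b (Gt g (psize pi + k) pi) = hallL (monomial (toExp pi) 1) h) :
    CC a b (Gk g k f) = hallL f h := by
  conv_rhs => rw [sum_support f]
  rw [Gk_eq, map_sum, map_sum, LinearMap.sum_apply]
  refine Finset.sum_congr rfl fun m _ => ?_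
  rw [map_smul, H, toExp_toPart, map_smul, LinearMap.smul_apply]

lemma part0 (pi : JPartition) : Gt g (psize pi) pi = (pi.map fun i => qv i + rv i).prod := by
  have h1 := PsiA_monomial (toExp pi)
  rw [toPart_toExp] at h1
  rw [← h1]
  refine CC_inj fun mu nu => ?_
  rw [g_zero hJ hg, hall_mul_eq]

lemma part1 (f : SymA) : Gk g 0 f = Psi f := by
  refine CC_inj fun mu nu => ?_
  rw [Psi_eq, ← hall_mul_eq]
  exact CC_Gk 0 f _ _ _ fun pi => g_zero hJ hg pi mu nu

lemma part2 (f : SymA) : Gk g 1 f = ∑ᶠ m : ℕ+, ∑ᶠ m1 : ℕ+, ∑ᶠ m2 : ℕ+,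
        if (m1 : ℕ) + (m2 : ℕ) = (m : ℕ) + 1 then
          qv m1 * rv m2 * Psi (((m : ℕ) : F) • MvPolynomial.pderiv m f)
        else 0 := by
  obtain ⟨M, hM⟩ := dd_large f
  rw [rhs_eq f M hM]
  refine CC_inj fun mu nu => ?_
  rw [CC_Op M f _ _ hM]
  exact CC_Gk 1 f _ _ _ fun pi => g_one hJ hg pi mu nu

end
end JA

/-- **Theorem 1.11, degrees 0 and 1.**  `𝒢_0^{(α)} = Ψ` and
`𝒢_1^{(α)} = ∑_{m≥1} ∑_{m₁+m₂=m+1, m₁,m₂≥1} q_{m₁} r_{m₂} ⬝ Ψ ⬝ (m ∂/∂p_m)`;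
in particular `∑_{|μ|+|ν|=|π|} g^π_{μ,ν}(α) q_μ r_ν = ∏_{1≤i≤ℓ(π)} (q_{π_i}+r_{π_i})`
for every partition `π`. -/
theorem statement2
    (J : JPartition → SymA) (hJ : IsJackFamily J)
    (g : JPartition → JPartition → JPartition → F) (hg : IsStructCoeffs J g) :
    (∀ f : SymA, Gk g 0 f = Psi f) ∧
    (∀ f : SymA, Gk g 1 f =
      ∑ᶠ m : ℕ+, ∑ᶠ m1 : ℕ+, ∑ᶠ m2 : ℕ+,
        if (m1 : ℕ) + (m2 : ℕ) = (m : ℕ) + 1 then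
          qv m1 * rv m2 * Psi (((m : ℕ) : F) • MvPolynomial.pderiv m f)
        else 0) ∧
    (∀ pi : JPartition,
      (∑ᶠ mu : JPartition, ∑ᶠ nu : JPartition,
          if psize mu + psize nu = psize pi then g pi mu nu • qrMon mu nu else 0)
        = (pi.map fun i => qv i + rv i).prod) := by
  exact ⟨JA.part1 hJ hg, JA.part2 hJ hg, JA.part0 hJ hg⟩

end
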